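/- arXiv:2605.18713 — 5 statements merged into one kernel-verified Lean document; each statement's English description precedes it below -/
import Mathlib

section
/- For every r ∈ (2, ∞) there exists a constant C_r > 0 depending only on r such that for every n and every function f : 𝕀^n → ℂ whose Fourier transform satisfies f̂(y) = 0 whenever |y| > n/2, one has ‖V_r(S_k f : k ∈ {1, 2, ..., ⌊n/2⌋})‖_2 ≤ C_r ‖f‖_2. -/
open scoped ENNReal

/-- The spherical mean of radius `k` on the hypercube `{0,1}^n`. -/
noncomputable def sphMean (n k : ℕ) (f : (Fin n → Bool) → ℂ) (x : Fin n → Bool) : ℂ :=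
  ((n.choose k : ℂ))⁻¹ * ∑ y ∈ Finset.univ.filter (fun y => hammingDist x y = k), f y

/-- The `r`-variation seminorm of `a` over the index set `Z`, valued in `[0,∞]`. -/
noncomputable def eVar {ι : Type*} [LinearOrder ι] (r : ℝ) (a : ι → ℂ) (Z : Set ι) : ℝ≥0∞ :=
  ⨆ (J : ℕ) (t : Fin (J + 1) → ι) (_ : StrictMono t) (_ : ∀ j, t j ∈ Z),
    (∑ j : Fin J, (ENNReal.ofReal ‖a (t j.castSucc) - a (t j.succ)‖) ^ r) ^ r⁻¹

/-- The `ℓ²` norm of a `[0,∞]`-valued function on the hypercube. -/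
noncomputable def eL2 {n : ℕ} (V : (Fin n → Bool) → ℝ≥0∞) : ℝ≥0∞ :=
  (∑ x : Fin n → Bool, V x ^ (2 : ℝ)) ^ ((2 : ℝ))⁻¹

/-- The `ℓ²` norm of a complex function on the hypercube. -/
noncomputable def l2Norm {n : ℕ} (f : (Fin n → Bool) → ℂ) : ℝ :=
  Real.sqrt (∑ x : Fin n → Bool, ‖f x‖ ^ 2)

/-- The length (number of ones) of an element of the hypercube. -/
def wt {n : ℕ} (x : Fin n → Bool) : ℕ := (Finset.univ.filter (fun j => x j = true)).card

/-- The character `χ_y(x) = (-1)^{x·y}` on the hypercube. -/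
noncomputable def chi {n : ℕ} (y x : Fin n → Bool) : ℂ :=
  (-1) ^ ((Finset.univ.filter (fun j => x j = true ∧ y j = true)).card)

/-- The Fourier transform on the hypercube: `f̂(y) = 2^{-n/2} ∑_x f(x) χ_y(x)`. -/
noncomputable def fourierT {n : ℕ} (f : (Fin n → Bool) → ℂ) (y : Fin n → Bool) : ℂ :=
  ((Real.sqrt (2 ^ n) : ℂ))⁻¹ * ∑ x : Fin n → Bool, f x * chi y x

namespace SphVar

/-- running maximum -/
noncomputable def Mx (a : ℕ → ℂ) : ℕ → ℝ
  | 0 => ‖a 0‖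
  | t + 1 => max (Mx a t) ‖a (t + 1)‖

/-- value at the last stopping time -/
noncomputable def sg (ε : ℝ) (a : ℕ → ℂ) : ℕ → ℂ
  | 0 => a 0
  | t + 1 => if ε * Mx a (t + 1) < ‖a (t + 1) - sg ε a t‖ then a (t + 1) else sg ε a t

/-- quadratic variation along the stopping times -/
noncomputable def Qv (ε : ℝ) (a : ℕ → ℂ) : ℕ → ℝ
  | 0 => 0
  | t + 1 => Qv ε a t + ‖sg ε a (t + 1) - sg ε a t‖ ^ 2

lemma Mx_congr {a b : ℕ → ℂ} {t : ℕ} (h : ∀ i ≤ t, a i = b i) : Mx a t = Mx b t := by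
  induction t with
  | zero => simp [Mx, h 0 le_rfl]
  | succ t ih => simp [Mx, h (t + 1) le_rfl, ih (fun i hi => h i (by omega))]

lemma sg_congr {ε : ℝ} {a b : ℕ → ℂ} {t : ℕ} (h : ∀ i ≤ t, a i = b i) :
    sg ε a t = sg ε b t := by
  induction t with
  | zero => simp [sg, h 0 le_rfl]
  | succ t ih =>
    simp only [sg, h (t + 1) le_rfl, ih (fun i hi => h i (by omega)), Mx_congr h]

lemma norm_le_Mx (a : ℕ → ℂ) (t : ℕ) : ‖a t‖ ≤ Mx a t := by
  cases t <;> simp [Mx]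

lemma Mx_nonneg (a : ℕ → ℂ) (t : ℕ) : 0 ≤ Mx a t := (norm_nonneg _).trans (norm_le_Mx a t)

lemma Mx_mono (a : ℕ → ℂ) : Monotone (Mx a) :=
  monotone_nat_of_le_succ (fun t => by simp [Mx])

lemma Qv_mono (ε : ℝ) (a : ℕ → ℂ) : Monotone (Qv ε a) :=
  monotone_nat_of_le_succ (fun t => by simp only [Qv]; nlinarith [sq_nonneg ‖sg ε a (t + 1) - sg ε a t‖])

lemma Qv_nonneg (ε : ℝ) (a : ℕ → ℂ) (t : ℕ) : 0 ≤ Qv ε a t := by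
  have := Qv_mono ε a (Nat.zero_le t)
  simpa [Qv] using this

lemma dist_sg {ε : ℝ} (hε : 0 ≤ ε) (a : ℕ → ℂ) (t : ℕ) : ‖a t - sg ε a t‖ ≤ ε * Mx a t := by
  cases t with
  | zero => simpa [sg] using mul_nonneg hε (Mx_nonneg a 0)
  | succ t =>
    simp only [sg]
    split_ifs with h
    · simpa using mul_nonneg hε (Mx_nonneg a (t + 1))
    · exact not_lt.mp h

lemma sg_jump {ε : ℝ} (hε : 0 ≤ ε) (a : ℕ → ℂ) {s t : ℕ} (hst : s ≤ t) :
    sg ε a t = sg ε a s ∨ (ε * Mx a s) ^ 2 ≤ Qv ε a t - Qv ε a s := by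
  induction t, hst using Nat.le_induction with
  | base => left; rfl
  | succ t hst ih =>
    rcases ih with ih | ih
    · by_cases h : ε * Mx a (t + 1) < ‖a (t + 1) - sg ε a t‖
      · right
        have h1 : sg ε a (t + 1) = a (t + 1) := by simp only [sg, if_pos h]
        have h2 : ε * Mx a s ≤ ‖a (t + 1) - sg ε a t‖ :=
          (mul_le_mul_of_nonneg_left (Mx_mono a (by omega)) hε).trans h.le
        have h3 : (ε * Mx a s) ^ 2 ≤ ‖a (t + 1) - sg ε a t‖ ^ 2 :=
          pow_le_pow_left₀ (mul_nonneg hε (Mx_nonneg a s)) h2 2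
        have h4 := Qv_mono ε a hst
        simp only [Qv, h1]
        linarith
      · left
        rw [← ih]
        simp only [sg, if_neg h]
    · right
      have := Qv_mono ε a (Nat.le_succ t)
      simp only [Nat.succ_eq_add_one] at this
      linarith

lemma jump_Q {ε : ℝ} (hε : 0 ≤ ε) (a : ℕ → ℂ) {s t : ℕ} (hst : s ≤ t)
    (h : 2 * ε * Mx a t < ‖a t - a s‖) : (ε * Mx a s) ^ 2 ≤ Qv ε a t - Qv ε a s := by
  rcases sg_jump hε a hst with h1 | h1
  · exfalso
    have h2 := dist_sg hε a t
    have h3 := dist_sg hε a s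
    have h4 : ε * Mx a s ≤ ε * Mx a t := mul_le_mul_of_nonneg_left (Mx_mono a hst) hε
    have h5 : ‖a t - a s‖ ≤ ‖a t - sg ε a t‖ + ‖a s - sg ε a s‖ := by
      rw [h1]
      have : a t - a s = (a t - sg ε a s) - (a s - sg ε a s) := by ring
      rw [this]; exact norm_sub_le _ _
    linarith
  · exact h1

lemma Qv_identity (ε : ℝ) (a : ℕ → ℂ) (t : ℕ) :
    Qv ε a t + ‖a t - sg ε a t‖ ^ 2 = ‖a t‖ ^ 2 - ‖a 0‖ ^ 2
      - 2 * ∑ i ∈ Finset.range t, ((starRingEnd ℂ) (sg ε a i) * (a (i + 1) - a i)).re := by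
  induction t with
  | zero => simp [Qv, sg]
  | succ t ih =>
    have key : Qv ε a (t + 1) + ‖a (t + 1) - sg ε a (t + 1)‖ ^ 2
        = Qv ε a t + ‖a (t + 1) - sg ε a t‖ ^ 2 := by
      by_cases h : ε * Mx a (t + 1) < ‖a (t + 1) - sg ε a t‖
      · have h1 : sg ε a (t + 1) = a (t + 1) := by simp only [sg, if_pos h]
        simp [Qv, h1]
      · have h1 : sg ε a (t + 1) = sg ε a t := by simp only [sg, if_neg h]
        simp [Qv, h1]
    rw [key, Finset.sum_range_succ]
    have e : ∀ z : ℂ, ‖z‖ ^ 2 = z.re ^ 2 + z.im ^ 2 := fun z => by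
      rw [Complex.sq_norm, Complex.normSq_apply]; ring
    simp only [e, Complex.sub_re, Complex.sub_im, Complex.mul_re, Complex.conj_re,
      Complex.conj_im] at ih ⊢
    linarith

lemma Qv_le (ε : ℝ) (a : ℕ → ℂ) (t : ℕ) :
    Qv ε a t ≤ ‖a t‖ ^ 2
      - 2 * ∑ i ∈ Finset.range t, ((starRingEnd ℂ) (sg ε a i) * (a (i + 1) - a i)).re := by
  have := Qv_identity ε a t
  nlinarith [sq_nonneg ‖a t - sg ε a t‖, sq_nonneg ‖a 0‖]

/-- the unimodular direction of the running value times the running maximum -/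
noncomputable def dr (a : ℕ → ℂ) (t : ℕ) : ℂ := (Mx a t : ℂ) * (a t / (‖a t‖ : ℂ))

lemma dr_congr {a b : ℕ → ℂ} {t : ℕ} (h : ∀ i ≤ t, a i = b i) : dr a t = dr b t := by
  simp only [dr, Mx_congr h, h t le_rfl]

lemma dr_le (a : ℕ → ℂ) (t : ℕ) :
    ((starRingEnd ℂ) (dr a t) * (a (t + 1) - a t)).re ≤ Mx a t * (‖a (t + 1)‖ - ‖a t‖) := by
  have hM := Mx_nonneg a t
  have e : ((starRingEnd ℂ) (dr a t) * (a (t + 1) - a t)).re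
      = Mx a t * (((starRingEnd ℂ) (a t / (‖a t‖ : ℂ)) * a (t + 1)).re
        - ((starRingEnd ℂ) (a t / (‖a t‖ : ℂ)) * a t).re) := by
    have : (starRingEnd ℂ) (dr a t) * (a (t + 1) - a t) =
      ((Mx a t : ℝ) : ℂ) * ((starRingEnd ℂ) (a t / (‖a t‖ : ℂ)) * a (t + 1)
        - (starRingEnd ℂ) (a t / (‖a t‖ : ℂ)) * a t) := by
      simp only [dr, map_mul, Complex.conj_ofReal]; ring
    rw [this, Complex.re_ofReal_mul, Complex.sub_re]
  rw [e]
  apply mul_le_mul_of_nonneg_left _ hM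
  have hu : ‖a t / (‖a t‖ : ℂ)‖ ≤ 1 := by
    rw [norm_div, Complex.norm_real, norm_norm]; exact div_self_le_one _
  have h1 : ((starRingEnd ℂ) (a t / (‖a t‖ : ℂ)) * a (t + 1)).re ≤ ‖a (t + 1)‖ := by
    refine (Complex.re_le_norm _).trans ?_
    rw [norm_mul, RCLike.norm_conj]
    exact mul_le_of_le_one_left (norm_nonneg _) hu
  have h2 : ((starRingEnd ℂ) (a t / (‖a t‖ : ℂ)) * a t).re = ‖a t‖ := by
    by_cases h0 : a t = 0
    · simp [h0]
    · have hn : (‖a t‖ : ℂ) ≠ 0 := by simpa using h0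
      have : (starRingEnd ℂ) (a t / (‖a t‖ : ℂ)) * a t = (‖a t‖ : ℂ) := by
        rw [map_div₀, Complex.conj_ofReal, div_mul_eq_mul_div, mul_comm, Complex.mul_conj,
          Complex.normSq_eq_norm_sq]
        field_simp
        push_cast; ring
      rw [this, Complex.ofReal_re]
  linarith

lemma doob_path (a : ℕ → ℂ) (t : ℕ) :
    Mx a t ^ 2 ≤ 4 * ‖a t‖ ^ 2
      - 4 * ∑ i ∈ Finset.range t, ((starRingEnd ℂ) (dr a i) * (a (i + 1) - a i)).re := by
  have h1 : Mx a t ^ 2 ≤ 2 * Mx a t * ‖a t‖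
      - 2 * ∑ i ∈ Finset.range t, Mx a i * (‖a (i + 1)‖ - ‖a i‖) := by
    induction t with
    | zero => simp [Mx]; nlinarith [sq_nonneg ‖a 0‖]
    | succ t ih =>
      rw [Finset.sum_range_succ]
      simp only [Mx]
      rcases max_cases (Mx a t) ‖a (t + 1)‖ with ⟨h, h'⟩ | ⟨h, h'⟩ <;> rw [h]
      · nlinarith
      · nlinarith
  have h2 : ∑ i ∈ Finset.range t, ((starRingEnd ℂ) (dr a i) * (a (i + 1) - a i)).re
      ≤ ∑ i ∈ Finset.range t, Mx a i * (‖a (i + 1)‖ - ‖a i‖) :=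
    Finset.sum_le_sum (fun i _ => dr_le a i)
  nlinarith [sq_nonneg (Mx a t - 2 * ‖a t‖)]

/-- the control function -/
noncomputable def Psi (r : ℝ) (n : ℕ) (a : ℕ → ℂ) (t : ℕ) : ℝ :=
  (64 * 4 ^ r) * (Mx a t ^ r
    + Mx a n ^ (r - 2) * ∑ m ∈ Finset.range (n + 1), ((1 / 2 : ℝ) ^ (r - 2)) ^ m * Qv ((1 / 2) ^ m) a t
    + Mx a n ^ r * (t / 2 ^ n))

lemma jump_le_Psi {r : ℝ} (hr : 2 < r) (n : ℕ) (a : ℕ → ℂ) {s t : ℕ} (hst : s ≤ t) (htn : t ≤ n) :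
    ‖a t - a s‖ ^ r ≤ Psi r n a t - Psi r n a s := by
  have hr0 : 0 < r := by linarith
  set d := ‖a t - a s‖ with hd
  have hd0 : 0 ≤ d := norm_nonneg _
  have hMs := Mx_nonneg a s
  have hMt := Mx_nonneg a t
  have hMn := Mx_nonneg a n
  have hMst := Mx_mono a hst
  have hMtn := Mx_mono a htn
  have hd2 : d ≤ 2 * Mx a t := by
    have h1 := norm_sub_le (a t) (a s)
    have h2 := norm_le_Mx a t
    have h3 := norm_le_Mx a s
    linarith
  have h4r : (0 : ℝ) < 4 ^ r := by positivity
  have h24 : (2 : ℝ) ^ r ≤ 4 ^ r := Real.rpow_le_rpow (by norm_num) (by norm_num) hr0.le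
  set q : ℝ := (1 / 2 : ℝ) ^ (r - 2) with hq
  have hq0 : 0 < q := by positivity
  -- three nonneg pieces
  have A1 : 0 ≤ Mx a t ^ r - Mx a s ^ r := sub_nonneg.2 (Real.rpow_le_rpow hMs hMst hr0.le)
  have A2' : ∀ m ∈ Finset.range (n + 1),
      0 ≤ q ^ m * (Qv ((1 / 2) ^ m) a t - Qv ((1 / 2) ^ m) a s) := fun m _ =>
    mul_nonneg (by positivity) (sub_nonneg.2 (Qv_mono _ a hst))
  have A2 : 0 ≤ Mx a n ^ (r - 2) * ∑ m ∈ Finset.range (n + 1),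
      q ^ m * (Qv ((1 / 2) ^ m) a t - Qv ((1 / 2) ^ m) a s) :=
    mul_nonneg (by positivity) (Finset.sum_nonneg A2')
  have hst' : (s : ℝ) ≤ t := by exact_mod_cast hst
  have A3 : 0 ≤ Mx a n ^ r * (((t : ℝ) - s) / 2 ^ n) :=
    mul_nonneg (by positivity) (div_nonneg (by linarith) (by positivity))
  have E : Psi r n a t - Psi r n a s = (64 * 4 ^ r) * ((Mx a t ^ r - Mx a s ^ r)
      + Mx a n ^ (r - 2) * (∑ m ∈ Finset.range (n + 1),
      q ^ m * (Qv ((1 / 2) ^ m) a t - Qv ((1 / 2) ^ m) a s))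
      + Mx a n ^ r * (((t : ℝ) - s) / 2 ^ n)) := by
    simp only [Psi, mul_sub, Finset.sum_sub_distrib, ← hq]
    ring
  rw [E]
  by_cases c1 : 2 * Mx a s < Mx a t
  · have h1 : d ^ r ≤ 2 ^ r * Mx a t ^ r := by
      rw [← Real.mul_rpow (by norm_num) hMt]
      exact Real.rpow_le_rpow hd0 hd2 hr0.le
    have h2 : 4 * Mx a s ^ r ≤ Mx a t ^ r := by
      have e4 : (4 : ℝ) ≤ 2 ^ r := by
        have : (2 : ℝ) ^ (2 : ℝ) ≤ 2 ^ r := Real.rpow_le_rpow_of_exponent_le (by norm_num) hr.le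
        norm_num at this
        exact this
      have : (2 * Mx a s) ^ r ≤ Mx a t ^ r := Real.rpow_le_rpow (by positivity) c1.le hr0.le
      rw [Real.mul_rpow (by norm_num) hMs] at this
      have h0 : 0 ≤ Mx a s ^ r := by positivity
      nlinarith
    have h0 : 0 ≤ Mx a s ^ r := by positivity
    calc d ^ r ≤ 4 ^ r * Mx a t ^ r := h1.trans (mul_le_mul_of_nonneg_right h24 (by positivity))
      _ ≤ 4 ^ r * (64 * (Mx a t ^ r - Mx a s ^ r)) := by
          apply mul_le_mul_of_nonneg_left _ h4r.le; nlinarith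
      _ = (64 * 4 ^ r) * (Mx a t ^ r - Mx a s ^ r) := by ring
      _ ≤ _ := by
          apply mul_le_mul_of_nonneg_left _ (by positivity); linarith
  push Not at c1
  by_cases c2 : d ≤ 4 * (1 / 2) ^ n * Mx a t
  · rcases hst.eq_or_lt with rfl | hlt
    · have : d = 0 := by simp [hd]
      rw [this, Real.zero_rpow hr0.ne']
      apply mul_nonneg (by positivity); linarith
    · have h1 : d ≤ 4 * ((1 / 2) ^ n * Mx a n) := by
        refine c2.trans ?_
        rw [mul_assoc]
        gcongr
      have h2 : d ^ r ≤ 4 ^ r * (((1 / 2) ^ n) ^ r * Mx a n ^ r) := by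
        rw [← Real.mul_rpow (by positivity) hMn, ← Real.mul_rpow (by norm_num) (by positivity)]
        exact Real.rpow_le_rpow hd0 h1 hr0.le
      have h3 : (((1 / 2 : ℝ)) ^ n) ^ r ≤ (1 / 2) ^ n := by
        have := Real.rpow_le_rpow_of_exponent_ge (x := (1 / 2 : ℝ) ^ n) (by positivity)
          (pow_le_one₀ (by norm_num) (by norm_num)) (show (1 : ℝ) ≤ r by linarith)
        simpa using this
      have h4 : (1 : ℝ) ≤ (t : ℝ) - s := by
        have : (s : ℝ) + 1 ≤ t := by exact_mod_cast hlt
        linarith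
      have h5 : (1 / 2 : ℝ) ^ n ≤ ((t : ℝ) - s) / 2 ^ n := by
        rw [div_pow, one_pow]
        gcongr
      have h6 : 0 ≤ Mx a n ^ r := by positivity
      calc d ^ r ≤ 4 ^ r * (((1 / 2) ^ n) ^ r * Mx a n ^ r) := h2
        _ ≤ 4 ^ r * ((((t : ℝ) - s) / 2 ^ n) * Mx a n ^ r) := by
          have := h3.trans h5
          gcongr
        _ ≤ (64 * 4 ^ r) * (Mx a n ^ r * (((t : ℝ) - s) / 2 ^ n)) := by
          have : 0 ≤ 4 ^ r * (Mx a n ^ r * (((t : ℝ) - s) / 2 ^ n)) := mul_nonneg h4r.le A3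
          linarith
        _ ≤ _ := by
          apply mul_le_mul_of_nonneg_left _ (by positivity); linarith
  push Not at c2
  have hdpos : 0 < d := lt_of_le_of_lt (by positivity) c2
  have hex : ∃ m : ℕ, 2 * (1 / 2) ^ m * Mx a t < d :=
    ⟨n, lt_of_le_of_lt (by gcongr; norm_num) c2⟩
  classical
  obtain ⟨m, hm, hmn, hm'⟩ : ∃ m : ℕ, 2 * (1 / 2) ^ m * Mx a t < d ∧ m ≤ n ∧
      d ≤ 4 * (1 / 2) ^ m * Mx a t := by
    refine ⟨Nat.find hex, Nat.find_spec hex, Nat.find_min' hex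
      (lt_of_le_of_lt (by gcongr; norm_num) c2), ?_⟩
    have h0 : Nat.find hex ≠ 0 := by
      intro h
      have := Nat.find_spec hex
      rw [h] at this
      simp at this
      linarith
    obtain ⟨p, hp⟩ := Nat.exists_eq_succ_of_ne_zero h0
    have h1 := Nat.find_min hex (m := p) (by omega)
    push Not at h1
    rw [hp, Nat.succ_eq_add_one, pow_succ]
    linarith
  have hε : (0 : ℝ) ≤ (1 / 2) ^ m := by positivity
  have hQ := jump_Q hε a hst hm
  set ε : ℝ := (1 / 2) ^ m with hεd
  have hQ2 : d ^ 2 ≤ 64 * (Qv ε a t - Qv ε a s) := by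
    have h1 : d ≤ 8 * (ε * Mx a s) := by nlinarith
    have h2 : d ^ 2 ≤ (8 * (ε * Mx a s)) ^ 2 := pow_le_pow_left₀ hd0 h1 2
    nlinarith
  have hd3 : d ^ (r - 2) ≤ 4 ^ r * (q ^ m * Mx a n ^ (r - 2)) := by
    have h1 : d ≤ 4 * (ε * Mx a n) := by
      refine hm'.trans ?_
      rw [mul_assoc]; gcongr
    have h2 : ε ^ (r - 2) = q ^ m := by
      rw [hq, hεd, ← Real.rpow_natCast, ← Real.rpow_natCast, ← Real.rpow_mul (by norm_num),
        ← Real.rpow_mul (by norm_num), mul_comm]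
    calc d ^ (r - 2) ≤ (4 * (ε * Mx a n)) ^ (r - 2) :=
          Real.rpow_le_rpow hd0 h1 (by linarith)
      _ = 4 ^ (r - 2) * (q ^ m * Mx a n ^ (r - 2)) := by
          rw [Real.mul_rpow (by norm_num) (by positivity), Real.mul_rpow hε hMn, h2]
      _ ≤ _ := by
          gcongr
          · norm_num
          · linarith
  have hdr : d ^ r = d ^ (r - 2) * d ^ 2 := by
    rw [← Real.rpow_natCast d 2, ← Real.rpow_add hdpos]; norm_num
  have hQ0 : 0 ≤ Qv ε a t - Qv ε a s := sub_nonneg.2 (Qv_mono _ a hst)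
  calc d ^ r ≤ (4 ^ r * (q ^ m * Mx a n ^ (r - 2))) * (64 * (Qv ε a t - Qv ε a s)) := by
        rw [hdr]
        exact mul_le_mul hd3 hQ2 (by positivity) (by positivity)
    _ = (64 * 4 ^ r) * (Mx a n ^ (r - 2) * (q ^ m * (Qv ε a t - Qv ε a s))) := by ring
    _ ≤ (64 * 4 ^ r) * (Mx a n ^ (r - 2) * ∑ m ∈ Finset.range (n + 1),
      q ^ m * (Qv ((1 / 2) ^ m) a t - Qv ((1 / 2) ^ m) a s)) := by
        have := Finset.single_le_sum A2' (Finset.mem_range.2 (Nat.lt_succ_of_le hmn))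
        gcongr
    _ ≤ _ := by
        apply mul_le_mul_of_nonneg_left _ (by positivity); linarith

/-- the dominating functional -/
noncomputable def Lf (r : ℝ) (n : ℕ) (a : ℕ → ℂ) : ℝ :=
  2 * Mx a n ^ 2 + ∑ m ∈ Finset.range (n + 1), ((1 / 2 : ℝ) ^ (r - 2)) ^ m * Qv ((1 / 2) ^ m) a n

lemma Lf_nonneg (r : ℝ) (n : ℕ) (a : ℕ → ℂ) : 0 ≤ Lf r n a := by
  have := Mx_nonneg a n
  refine add_nonneg (by positivity) (Finset.sum_nonneg fun m _ => mul_nonneg (by positivity) (Qv_nonneg _ _ _))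

lemma Psi_nonneg (r : ℝ) (n : ℕ) (a : ℕ → ℂ) (t : ℕ) : 0 ≤ Psi r n a t := by
  have := Mx_nonneg a n
  have := Mx_nonneg a t
  have h : 0 ≤ ∑ m ∈ Finset.range (n + 1), ((1 / 2 : ℝ) ^ (r - 2)) ^ m * Qv ((1 / 2) ^ m) a t :=
    Finset.sum_nonneg fun m _ => mul_nonneg (by positivity) (Qv_nonneg _ _ _)
  unfold Psi
  positivity

lemma Psi_mono {r : ℝ} (hr : 2 < r) (n : ℕ) (a : ℕ → ℂ) {s t : ℕ} (hst : s ≤ t) (htn : t ≤ n) :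
    Psi r n a s ≤ Psi r n a t := by
  have := jump_le_Psi hr n a hst htn
  have h : 0 ≤ ‖a t - a s‖ ^ r := by positivity
  linarith

lemma Psi_le {r : ℝ} (hr : 2 < r) (n : ℕ) (a : ℕ → ℂ) :
    Psi r n a n ≤ (64 * 4 ^ r) * Lf r n a ^ (r / 2) := by
  unfold Psi
  have hM := Mx_nonneg a n
  have hL := Lf_nonneg r n a
  have hQ : 0 ≤ ∑ m ∈ Finset.range (n + 1), ((1 / 2 : ℝ) ^ (r - 2)) ^ m * Qv ((1 / 2) ^ m) a n :=
    Finset.sum_nonneg fun m _ => mul_nonneg (by positivity) (Qv_nonneg _ _ _)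
  apply mul_le_mul_of_nonneg_left _ (by positivity)
  have h1 : Mx a n ^ r = Mx a n ^ (r - 2) * Mx a n ^ 2 := by
    rw [← Real.rpow_natCast (Mx a n) 2, ← Real.rpow_add_of_nonneg hM (by linarith) (by norm_num)]
    norm_num
  have h2 : (n : ℝ) / 2 ^ n ≤ 1 := by
    rw [div_le_one (by positivity)]
    exact_mod_cast (Nat.lt_two_pow_self).le
  have h3 : Mx a n ^ r * (n / 2 ^ n) ≤ Mx a n ^ r := mul_le_of_le_one_right (by positivity) h2
  have h4 : Mx a n ^ (r - 2) ≤ Lf r n a ^ ((r - 2) / 2) := by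
    have : Mx a n ^ (r - 2) = (Mx a n ^ 2) ^ ((r - 2) / 2) := by
      rw [← Real.rpow_natCast (Mx a n) 2, ← Real.rpow_mul hM]; congr 1; push_cast; ring
    rw [this]
    apply Real.rpow_le_rpow (by positivity) _ (by linarith)
    unfold Lf; nlinarith
  have h5 : Lf r n a ^ (r / 2) = Lf r n a ^ ((r - 2) / 2) * Lf r n a := by
    conv_rhs => rw [← Real.rpow_one (Lf r n a), ← Real.rpow_mul hL,
      ← Real.rpow_add_of_nonneg hL (by linarith) (by norm_num)]
    congr 1; ring
  rw [h5]
  calc _ ≤ Mx a n ^ (r - 2) * Lf r n a := by unfold Lf; linarith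
    _ ≤ _ := mul_le_mul_of_nonneg_right h4 hL

end SphVar

namespace SphVar
open Polynomial

/-- Krawtchouk generating polynomial -/
noncomputable def KG (n x : ℕ) : ℝ[X] := (1 - X) ^ x * (1 + X) ^ (n - x)

/-- Krawtchouk number -/
noncomputable def Kr (n k x : ℕ) : ℝ := (KG n x).coeff k

/-- normalised Krawtchouk number -/
noncomputable def ka (n k x : ℕ) : ℝ := Kr n k x / (n.choose k : ℝ)

lemma KG_eq (n x : ℕ) (h : 2 * x ≤ n) : KG n x = (1 - X ^ 2) ^ x * (1 + X) ^ (n - 2 * x) := by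
  have e : n - x = x + (n - 2 * x) := by omega
  rw [KG, e, pow_add, ← mul_assoc, ← mul_pow]
  congr 2; ring

lemma Kr_zero (n x : ℕ) : Kr n 0 x = 1 := by
  simp [Kr, KG, coeff_zero_eq_eval_zero]

lemma KG_x_zero (n k : ℕ) : Kr n k 0 = n.choose k := by
  simp [Kr, KG, coeff_one_add_X_pow]

/-- first recursion : X G' -/
lemma KG_deriv (n x : ℕ) (h : 2 * (x + 1) ≤ n) :
    derivative (KG n (x + 1)) = - (2 * ((x : ℝ[X]) + 1)) * X * KG (n - 2) x
      + ((n : ℝ[X]) - 2 * ((x : ℝ[X]) + 1)) * KG (n - 1) (x + 1) := by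
  rcases h.eq_or_lt with h | h
  · subst h
    rw [KG_eq (2 * (x + 1)) _ (by omega), KG_eq (2 * (x + 1) - 2) _ (by omega)]
    have e2 : 2 * (x + 1) - 2 - 2 * x = 0 := by omega
    simp only [Nat.sub_self, e2, pow_zero, mul_one]
    simp only [derivative_pow, derivative_sub, derivative_one, derivative_X, Nat.add_sub_cancel]
    simp [map_ofNat C 2]
    ring
  · obtain ⟨p, rfl⟩ : ∃ p, n = 2 * (x + 1) + (p + 1) := ⟨n - 2 * (x + 1) - 1, by omega⟩
    rw [KG_eq _ _ (by omega), KG_eq _ _ (by omega), KG_eq _ _ (by omega)]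
    have e1 : 2 * (x + 1) + (p + 1) - 2 * (x + 1) = p + 1 := by omega
    have e2 : 2 * (x + 1) + (p + 1) - 2 - 2 * x = p + 1 := by omega
    have e3 : 2 * (x + 1) + (p + 1) - 1 - 2 * (x + 1) = p := by omega
    rw [e1, e2, e3]
    simp only [derivative_mul, derivative_pow, derivative_sub, derivative_add, derivative_one,
      derivative_X, Nat.add_sub_cancel]
    simp [map_ofNat C 2]
    ring

lemma Kr_rec (n k x : ℕ) (h : 2 * (x + 1) ≤ n) :
    ((k : ℝ) + 2) * Kr n (k + 2) (x + 1) = - (2 * ((x : ℝ) + 1)) * Kr (n - 2) k x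
      + ((n : ℝ) - 2 * (x + 1)) * Kr (n - 1) (k + 1) (x + 1) := by
  have := congrArg (fun p => coeff p (k + 1)) (KG_deriv n x h)
  simp only [coeff_derivative] at this
  have e : - (2 * ((x : ℝ[X]) + 1)) * X * KG (n - 2) x
      + ((n : ℝ[X]) - 2 * ((x : ℝ[X]) + 1)) * KG (n - 1) (x + 1)
      = C (- (2 * ((x : ℝ) + 1))) * (X * KG (n - 2) x)
        + C ((n : ℝ) - 2 * (x + 1)) * KG (n - 1) (x + 1) := by
    simp [map_ofNat C 2]; ring
  rw [e, coeff_add, coeff_C_mul, coeff_C_mul, coeff_X_mul] at this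
  push_cast at this
  simp only [Kr]
  rw [← this]; ring

lemma Kr_rec_one (n x : ℕ) (h : 2 * (x + 1) ≤ n) :
    Kr n 1 (x + 1) = (n : ℝ) - 2 * (x + 1) := by
  have := congrArg (fun p => coeff p 0) (KG_deriv n x h)
  simp only [coeff_derivative] at this
  have e : - (2 * ((x : ℝ[X]) + 1)) * X * KG (n - 2) x
      + ((n : ℝ[X]) - 2 * ((x : ℝ[X]) + 1)) * KG (n - 1) (x + 1)
      = C (- (2 * ((x : ℝ) + 1))) * (X * KG (n - 2) x)
        + C ((n : ℝ) - 2 * (x + 1)) * KG (n - 1) (x + 1) := by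
    simp [map_ofNat C 2]; ring
  rw [e, coeff_add, coeff_C_mul, coeff_C_mul, coeff_X_mul_zero] at this
  have h0 := Kr_zero (n - 1) (x + 1)
  simp only [Kr] at h0 ⊢
  rw [h0] at this
  simpa using this

/-- difference identity -/
lemma KG_diff (n x : ℕ) (h : x + 1 ≤ n) :
    (1 + X) * derivative (KG n (x + 1)) - (n : ℝ[X]) * KG n (x + 1)
      = - (2 * ((x : ℝ[X]) + 1)) * KG (n - 1) x := by
  obtain ⟨p, rfl⟩ : ∃ p, n = x + 1 + p := ⟨n - (x + 1), by omega⟩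
  have e1 : x + 1 + p - (x + 1) = p := by omega
  have e2 : x + 1 + p - 1 - x = p := by omega
  simp only [KG, e1, e2]
  rcases p with _ | p
  · simp [derivative_pow]; ring
  · simp only [derivative_mul, derivative_pow, derivative_sub, derivative_add, derivative_one,
      derivative_X, Nat.add_sub_cancel]
    simp [map_ofNat C 2]
    ring

lemma Kr_diff (n k x : ℕ) (h : x + 1 ≤ n) :
    ((k : ℝ) + 1) * Kr n (k + 1) (x + 1) - ((n : ℝ) - k) * Kr n k (x + 1)
      = - (2 * ((x : ℝ) + 1)) * Kr (n - 1) k x := by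
  have := congrArg (fun p => coeff p k) (KG_diff n x h)
  beta_reduce at this
  have e1 : - (2 * ((x : ℝ[X]) + 1)) * KG (n - 1) x = C (- (2 * ((x : ℝ) + 1))) * KG (n - 1) x := by
    simp [map_ofNat C 2]
  have e2 : (1 + X) * derivative (KG n (x + 1)) - (n : ℝ[X]) * KG n (x + 1)
     = derivative (KG n (x + 1)) + X * derivative (KG n (x + 1)) - C (n : ℝ) * KG n (x + 1) := by
    simp [map_ofNat C 2]; ring
  rw [e1, e2, coeff_sub, coeff_add, coeff_C_mul, coeff_C_mul, coeff_derivative] at this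
  simp only [Kr]
  rw [← this]
  rcases k with _ | k
  · simp
  · rw [coeff_X_mul, coeff_derivative]; push_cast; ring

lemma ka_diff (n k x : ℕ) (hx : x + 1 ≤ n) (hk : k + 1 ≤ n) :
    ka n (k + 1) (x + 1) - ka n k (x + 1) = - (2 * ((x : ℝ) + 1) / n) * ka (n - 1) k x := by
  obtain ⟨p, rfl⟩ : ∃ p, n = p + 1 := ⟨n - 1, by omega⟩
  have h := Kr_diff (p + 1) k x hx
  simp only [Nat.add_sub_cancel] at h ⊢
  have c0 : (0 : ℝ) < ((p + 1).choose k : ℝ) := by exact_mod_cast Nat.choose_pos (by omega)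
  have c1 : (0 : ℝ) < ((p + 1).choose (k + 1) : ℝ) := by exact_mod_cast Nat.choose_pos hk
  have c2 : (0 : ℝ) < (p.choose k : ℝ) := by exact_mod_cast Nat.choose_pos (by omega)
  have i1 : ((p : ℝ) + 1) * p.choose k = (p + 1).choose (k + 1) * (k + 1) := by
    exact_mod_cast Nat.add_one_mul_choose_eq p k
  have i2 : ((p + 1).choose (k + 1) : ℝ) * (k + 1) = (p + 1).choose k * ((p : ℝ) + 1 - k) := by
    have := Nat.choose_succ_right_eq (p + 1) k
    have h' : ((p + 1 - k : ℕ) : ℝ) = (p : ℝ) + 1 - k := by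
      rw [Nat.cast_sub (by omega)]; push_cast; ring
    rw [← h']; exact_mod_cast this
  simp only [ka]
  push_cast at h ⊢
  have hp : (0 : ℝ) < (p : ℝ) + 1 := by positivity
  have hk1 : (0 : ℝ) < (k : ℝ) + 1 := by positivity
  have hpk : (0 : ℝ) < (p : ℝ) + 1 - k := by
    have : (k : ℝ) + 1 ≤ p + 1 := by exact_mod_cast hk
    linarith
  have E1 : Kr (p + 1) (k + 1) (x + 1) / ((p + 1).choose (k + 1) : ℝ)
     = ((k : ℝ) + 1) * Kr (p + 1) (k + 1) (x + 1) / (((p : ℝ) + 1) * p.choose k) := by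
    rw [i1]; field_simp
  have E2 : Kr (p + 1) k (x + 1) / ((p + 1).choose k : ℝ)
     = ((p : ℝ) + 1 - k) * Kr (p + 1) k (x + 1) / (((p : ℝ) + 1) * p.choose k) := by
    rw [i1, i2]; field_simp
  rw [E1, E2, ← sub_div, h]
  field_simp

lemma ka_zero (n x : ℕ) : ka n 0 x = 1 := by simp [ka, Kr_zero]

lemma ka_x_zero (n k : ℕ) (h : k ≤ n) : ka n k 0 = 1 := by
  rw [ka, KG_x_zero, div_self]
  exact_mod_cast (Nat.choose_pos h).ne'

lemma ka_rec (n k x : ℕ) (h : 2 * (x + 1) ≤ n) (hk : k + 2 ≤ n) :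
    ka n (k + 2) (x + 1) =
      - (2 * ((x : ℝ) + 1) / n) * (((k : ℝ) + 1) / (n - 1)) * ka (n - 2) k x
      + (1 - 2 * ((x : ℝ) + 1) / n) * ka (n - 1) (k + 1) (x + 1) := by
  obtain ⟨p, rfl⟩ : ∃ p, n = p + 2 := ⟨n - 2, by omega⟩
  have h := Kr_rec (p + 2) k x h
  have e1 : p + 2 - 1 = p + 1 := rfl
  simp only [Nat.add_sub_cancel, e1] at h ⊢
  have c1 : (0 : ℝ) < ((p + 2).choose (k + 2) : ℝ) := by exact_mod_cast Nat.choose_pos hk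
  have c0 : (0 : ℝ) < ((p + 1).choose (k + 1) : ℝ) := by exact_mod_cast Nat.choose_pos (by omega)
  have c2 : (0 : ℝ) < (p.choose k : ℝ) := by exact_mod_cast Nat.choose_pos (by omega)
  have i1 : ((p : ℝ) + 1) * p.choose k = (p + 1).choose (k + 1) * (k + 1) := by
    exact_mod_cast Nat.add_one_mul_choose_eq p k
  have i2 : ((p : ℝ) + 2) * (p + 1).choose (k + 1) = (p + 2).choose (k + 2) * (k + 2) := by
    exact_mod_cast Nat.add_one_mul_choose_eq (p + 1) (k + 1)
  simp only [ka]
  push_cast at h ⊢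
  have hp : (0 : ℝ) < (p : ℝ) + 1 := by positivity
  have hp2 : (0 : ℝ) < (p : ℝ) + 2 := by positivity
  have hk1 : (0 : ℝ) < (k : ℝ) + 1 := by positivity
  have hk2 : (0 : ℝ) < (k : ℝ) + 2 := by positivity
  have E1 : Kr (p + 2) (k + 2) (x + 1) / ((p + 2).choose (k + 2) : ℝ)
     = ((k : ℝ) + 2) * Kr (p + 2) (k + 2) (x + 1) / (((p : ℝ) + 2) * (p + 1).choose (k + 1)) := by
    rw [i2]; field_simp
  have E2 : (((k : ℝ) + 1) / ((p : ℝ) + 2 - 1)) * (Kr p k x / (p.choose k : ℝ))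
     = Kr p k x / ((p + 1).choose (k + 1) : ℝ) := by
    have : ((p + 1).choose (k + 1) : ℝ) = ((p : ℝ) + 1) * p.choose k / (k + 1) := by
      rw [i1]; field_simp
    rw [this, show (p : ℝ) + 2 - 1 = p + 1 by ring]; field_simp
  rw [mul_assoc, E2, E1, h]
  field_simp

lemma exp_small (u : ℝ) : (1 - u) * Real.exp u ≤ 1 := by
  have := Real.one_sub_le_exp_neg u
  have h := Real.exp_pos u
  calc (1 - u) * Real.exp u ≤ Real.exp (-u) * Real.exp u := by gcongr
    _ = 1 := by rw [← Real.exp_add]; simp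

lemma coef_ineq {u : ℝ} (h0 : 0 ≤ u) (h1 : u ≤ 1 / 2) :
    u * Real.exp (1 / 4) + (1 - 2 * u) * Real.exp (u / 4) ≤ 1 := by
  have a := exp_small (1 / 4)
  have b := exp_small (u / 4)
  have c := Real.exp_pos (u / 4)
  have b' : Real.exp (u / 4) ≤ 1 / (1 - u / 4) := by
    rw [le_div_iff₀ (by linarith)]; linarith
  have d : (1 - 2 * u) * (1 / (1 - u / 4)) ≤ 1 - 4 * u / 3 := by
    rw [mul_one_div, div_le_iff₀ (by linarith)]; nlinarith
  have e : (1 - 2 * u) * Real.exp (u / 4) ≤ (1 - 2 * u) * (1 / (1 - u / 4)) :=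
    mul_le_mul_of_nonneg_left b' (by linarith)
  nlinarith

lemma ka_decay : ∀ (k n x : ℕ), 2 * k ≤ n → 2 * x ≤ n →
    |ka n k x| ≤ Real.exp (-(k * x / n) / 4) := by
  intro k
  induction k using Nat.strong_induction_on with
  | _ k ih =>
  intro n x hk hx
  rcases x with _ | x
  · rw [ka_x_zero _ _ (by omega)]; simp
  have hn : 0 < n := by omega
  have hnR : (0 : ℝ) < n := by exact_mod_cast hn
  have hxR : 2 * ((x : ℝ) + 1) ≤ n := by exact_mod_cast hx
  set u : ℝ := ((x : ℝ) + 1) / n with hu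
  have hu0 : 0 ≤ u := by positivity
  have hu1 : u ≤ 1 / 2 := by rw [hu, div_le_iff₀ hnR]; linarith
  have hun : u * n = x + 1 := by rw [hu]; field_simp
  match k, ih, hk with
  | 0, _, _ => simp [ka_zero]
  | 1, _, hk =>
    have : ka n 1 (x + 1) = 1 - 2 * u := by
      rw [ka, Kr_rec_one n x hx, Nat.choose_one_right, hu]; field_simp
    rw [this, abs_of_nonneg (by linarith)]
    have h2 := Real.one_sub_le_exp_neg (2 * u)
    refine h2.trans (Real.exp_le_exp.2 ?_)
    push_cast
    rw [one_mul, ← hu]; linarith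
  | k + 2, ih, hk =>
    have hkR : 2 * ((k : ℝ) + 2) ≤ n := by exact_mod_cast hk
    have hn4 : (4 : ℝ) ≤ n := by linarith [(Nat.cast_nonneg k : (0 : ℝ) ≤ k)]
    have h1 := ih k (by omega) (n - 2) x (by omega) (by omega)
    have cn2 : ((n - 2 : ℕ) : ℝ) = n - 2 := by rw [Nat.cast_sub (by omega)]; norm_num
    have cn1 : ((n - 1 : ℕ) : ℝ) = n - 1 := by rw [Nat.cast_sub (by omega)]; norm_num
    rw [cn2] at h1
    rw [ka_rec n k x hx (by omega)]
    set E := Real.exp (-(((k + 2 : ℕ) : ℝ) * ((x + 1 : ℕ) : ℝ) / n) / 4) with hE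
    have hE0 : 0 < E := Real.exp_pos _
    have hk0 : (0 : ℝ) ≤ k := Nat.cast_nonneg k
    have hx0 : (0 : ℝ) ≤ x := Nat.cast_nonneg x
    have B1 : |ka (n - 2) k x| ≤ E * Real.exp (1 / 4) := by
      refine h1.trans ?_
      rw [hE, ← Real.exp_add]
      apply Real.exp_le_exp.2
      push_cast
      have : ((k : ℝ) + 2) * (x + 1) / n - k * x / (n - 2) ≤ 1 := by
        rw [div_sub_div _ _ (by linarith) (by linarith), div_le_one (mul_pos hnR (by linarith))]
        nlinarith [mul_nonneg (sub_nonneg.2 hkR) (sub_nonneg.2 hxR)]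
      linarith
    have B2 : (1 - 2 * u) * |ka (n - 1) (k + 1) (x + 1)| ≤ (1 - 2 * u) * (E * Real.exp (u / 4)) := by
      rcases hx.eq_or_lt with he | hlt
      · have : 2 * ((x : ℝ) + 1) = n := by exact_mod_cast he
        have : 1 - 2 * u = 0 := by rw [hu]; field_simp; linarith
        rw [this]; simp
      · have h2 := ih (k + 1) (by omega) (n - 1) (x + 1) (by omega) (by omega)
        apply mul_le_mul_of_nonneg_left _ (by linarith)
        refine h2.trans ?_
        rw [hE, ← Real.exp_add]
        apply Real.exp_le_exp.2
        rw [cn1]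
        push_cast
        have : ((k : ℝ) + 2) * (x + 1) / n - (k + 1) * (x + 1) / (n - 1) ≤ u := by
          rw [hu, div_sub_div _ _ (by linarith) (by linarith),
            div_le_div_iff₀ (mul_pos hnR (by linarith)) hnR]
          have : ((k : ℝ) + 2) * (x + 1) * (n - 1) - n * ((k + 1) * (x + 1))
            ≤ (x + 1) * (n - 1) := by nlinarith
          nlinarith
        linarith
    have B3 : ((k : ℝ) + 1) / (n - 1) ≤ 1 / 2 := by
      rw [div_le_iff₀ (by linarith)]; linarith
    have B30 : 0 ≤ ((k : ℝ) + 1) / (n - 1) := div_nonneg (by linarith) (by linarith)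
    have e2u : 2 * ((x : ℝ) + 1) / n = 2 * u := by rw [hu]; ring
    rw [e2u]
    calc |-(2 * u) * (((k : ℝ) + 1) / (n - 1)) * ka (n - 2) k x
            + (1 - 2 * u) * ka (n - 1) (k + 1) (x + 1)|
        ≤ |-(2 * u) * (((k : ℝ) + 1) / (n - 1)) * ka (n - 2) k x|
            + |(1 - 2 * u) * ka (n - 1) (k + 1) (x + 1)| := abs_add_le _ _
      _ = 2 * u * (((k : ℝ) + 1) / (n - 1)) * |ka (n - 2) k x|
            + (1 - 2 * u) * |ka (n - 1) (k + 1) (x + 1)| := by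
          rw [abs_mul, abs_mul, abs_neg, abs_of_nonneg B30, abs_mul (1 - 2 * u),
            abs_of_nonneg (show 0 ≤ 1 - 2 * u by linarith),
            abs_of_nonneg (show 0 ≤ 2 * u by linarith)]
      _ ≤ 2 * u * (1 / 2) * (E * Real.exp (1 / 4)) + (1 - 2 * u) * (E * Real.exp (u / 4)) := by
          gcongr
      _ = E * (u * Real.exp (1 / 4) + (1 - 2 * u) * Real.exp (u / 4)) := by ring
      _ ≤ E * 1 := by
          have := coef_ineq hu0 hu1
          gcongr
      _ = E := mul_one _

end SphVar

namespace SphVar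

/-- difference multiplier -/
noncomputable def dm (n k x : ℕ) : ℝ := ka n k x - (1 - (k : ℝ) / n) ^ x

lemma exp_quarter {v : ℝ} (hv : 0 ≤ v) : Real.exp (-v / 4) ≤ 64 / (1 + v) ^ 2 := by
  have h := Real.add_one_le_exp (v / 8)
  have h1 : (1 + v) / 8 ≤ Real.exp (v / 8) := by linarith
  have h2 : ((1 + v) / 8) ^ 2 ≤ Real.exp (v / 8) ^ 2 := pow_le_pow_left₀ (by linarith) h1 2
  have h3 : Real.exp (v / 8) ^ 2 = Real.exp (v / 4) := by
    rw [← Real.exp_nat_mul]; congr 1; push_cast; ring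
  rw [h3] at h2
  rw [neg_div, Real.exp_neg, inv_eq_one_div, div_le_div_iff₀ (Real.exp_pos _) (by positivity)]
  linarith

lemma ka_le_one {k n x : ℕ} (hk : 2 * k ≤ n) (hx : 2 * x ≤ n) : |ka n k x| ≤ 1 := by
  refine (ka_decay k n x hk hx).trans (Real.exp_le_one_iff.2 ?_)
  have : 0 ≤ (k : ℝ) * x / n := by positivity
  linarith

lemma ka_step {k n x : ℕ} (hk : 2 * (k + 1) ≤ n) (hx : 2 * x ≤ n) :
    |ka n (k + 1) x - ka n k x| ≤ 2 * (x / n) := by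
  rcases x with _ | x
  · rw [ka_x_zero _ _ (by omega), ka_x_zero _ _ (by omega)]; simp
  · rw [ka_diff n k x (by omega) (by omega), abs_mul, abs_neg]
    have h := ka_le_one (k := k) (n := n - 1) (x := x) (by omega) (by omega)
    have h0 : 0 ≤ 2 * ((x : ℝ) + 1) / n := by positivity
    rw [abs_of_nonneg h0]
    calc _ ≤ 2 * ((x : ℝ) + 1) / n * 1 := by gcongr
      _ = _ := by push_cast; ring

lemma ka_near {k n x : ℕ} (hk : 2 * k ≤ n) (hx : 2 * x ≤ n) :
    |ka n k x - 1| ≤ 2 * (k * (x / n)) := by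
  induction k with
  | zero => simp [ka_zero]
  | succ k ih =>
    have h1 := ih (by omega)
    have h2 := ka_step hk hx
    have h3 : |ka n (k + 1) x - 1| ≤ |ka n (k + 1) x - ka n k x| + |ka n k x - 1| := by
      have := abs_add_le (ka n (k + 1) x - ka n k x) (ka n k x - 1)
      simpa using this
    push_cast; linarith

lemma mu_le {k n x : ℕ} (hk : 2 * k ≤ n) : (1 - (k : ℝ) / n) ^ x ≤ Real.exp (-(k * (x / n))) := by
  have h1 : (k : ℝ) / n ≤ 1 := div_le_one_of_le₀ (by exact_mod_cast (by omega : k ≤ n)) (by positivity)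
  have h := Real.one_sub_le_exp_neg ((k : ℝ) / n)
  calc (1 - (k : ℝ) / n) ^ x ≤ Real.exp (-((k : ℝ) / n)) ^ x := pow_le_pow_left₀ (by linarith) h x
    _ = _ := by rw [← Real.exp_nat_mul]; congr 1; ring

lemma mu_near {k n x : ℕ} (hk : 2 * k ≤ n) :
    |(1 - (k : ℝ) / n) ^ x - 1| ≤ k * (x / n) := by
  have h1 : (k : ℝ) / n ≤ 1 := div_le_one_of_le₀ (by exact_mod_cast (by omega : k ≤ n)) (by positivity)
  have h0 : 0 ≤ (k : ℝ) / n := by positivity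
  have h2 : (1 - (k : ℝ) / n) ^ x ≤ 1 := pow_le_one₀ (by linarith) (by linarith)
  have h3 := one_add_mul_le_pow (a := -((k : ℝ) / n)) (by linarith) x
  rw [abs_of_nonpos (by linarith)]
  rw [← sub_eq_add_neg] at h3
  have : (x : ℝ) * -((k : ℝ) / n) = - (k * (x / n)) := by ring
  linarith

lemma pow_sub_le {a b : ℝ} (ha : 0 ≤ a) (hab : a ≤ b) (x : ℕ) :
    b ^ (x + 1) - a ^ (x + 1) ≤ (x + 1) * (b - a) * b ^ x := by
  induction x with
  | zero => simp
  | succ x ih =>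
    have h1 : a ^ (x + 1) ≤ b ^ (x + 1) := pow_le_pow_left₀ ha hab _
    have hb : 0 ≤ b := ha.trans hab
    have h2 := mul_le_mul_of_nonneg_right ih hb
    have h3 := mul_le_mul_of_nonneg_left h1 (sub_nonneg.2 hab)
    push_cast
    calc b ^ (x + 1 + 1) - a ^ (x + 1 + 1)
        = (b ^ (x + 1) - a ^ (x + 1)) * b + (b - a) * a ^ (x + 1) := by ring
      _ ≤ (x + 1) * (b - a) * b ^ x * b + (b - a) * b ^ (x + 1) := add_le_add h2 h3
      _ = _ := by ring

lemma mu_step {k n x : ℕ} (hk : 2 * (k + 1) ≤ n) :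
    |(1 - ((k + 1 : ℕ) : ℝ) / n) ^ x - (1 - (k : ℝ) / n) ^ x|
      ≤ 2 * (x / n) * Real.exp (-(k * (x / n))) := by
  rcases x with _ | x
  · simp
  have hnR : (0 : ℝ) < n := by exact_mod_cast (by omega : 0 < n)
  have hkR : 2 * ((k : ℝ) + 1) ≤ n := by exact_mod_cast hk
  have ha : 0 ≤ 1 - ((k + 1 : ℕ) : ℝ) / n := by
    rw [sub_nonneg, div_le_one hnR]; push_cast; linarith
  have hab : 1 - ((k + 1 : ℕ) : ℝ) / n ≤ 1 - (k : ℝ) / n := by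
    push_cast; gcongr; linarith
  have hb : 1 / 2 ≤ 1 - (k : ℝ) / n := by
    have : (k : ℝ) / n ≤ 1 / 2 := by rw [div_le_iff₀ hnR]; linarith
    linarith
  have h := pow_sub_le ha hab x
  have hm := mu_le (k := k) (n := n) (x := x + 1) (by omega)
  rw [abs_sub_comm, abs_of_nonneg (sub_nonneg.2 (pow_le_pow_left₀ ha hab _))]
  refine h.trans ?_
  set b := 1 - (k : ℝ) / n with hbd
  have e1 : b - (1 - ((k + 1 : ℕ) : ℝ) / n) = 1 / n := by rw [hbd]; push_cast; ring
  rw [e1]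
  have h2 : b ^ x ≤ 2 * b ^ (x + 1) := by
    have : 0 ≤ b ^ x := by positivity
    rw [pow_succ]; nlinarith
  calc ((x : ℝ) + 1) * (1 / n) * b ^ x
      ≤ ((x : ℝ) + 1) * (1 / n) * (2 * Real.exp (-(k * ((x + 1 : ℕ) / n)))) := by
        have := h2.trans (mul_le_mul_of_nonneg_left hm (by norm_num))
        gcongr
    _ = _ := by push_cast; ring

lemma ka_step' {k n x : ℕ} (hk : 2 * (k + 1) ≤ n) (hx : 2 * x ≤ n) :
    |ka n (k + 1) x - ka n k x| ≤ (8 / 3) * (x / n) * Real.exp (-(k * (x / n)) / 4) := by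
  rcases x with _ | x
  · rw [ka_x_zero _ _ (by omega), ka_x_zero _ _ (by omega)]; simp
  · rw [ka_diff n k x (by omega) (by omega), abs_mul, abs_neg]
    have h := ka_decay k (n - 1) x (by omega) (by omega)
    have cn1 : ((n - 1 : ℕ) : ℝ) = n - 1 := by rw [Nat.cast_sub (by omega)]; norm_num
    have hnR : (2 : ℝ) ≤ n := by exact_mod_cast (by omega : 2 ≤ n)
    have hkR : 2 * ((k : ℝ) + 1) ≤ n := by exact_mod_cast hk
    have hxR : 2 * ((x : ℝ) + 1) ≤ n := by exact_mod_cast hx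
    have hk0 : (0 : ℝ) ≤ k := Nat.cast_nonneg k
    have hx0 : (0 : ℝ) ≤ x := Nat.cast_nonneg x
    rw [cn1] at h
    have h1 : |ka (n - 1) k x| ≤ (4 / 3) * Real.exp (-(k * ((x + 1 : ℕ) / n)) / 4) := by
      have hq : Real.exp (1 / 4) ≤ 4 / 3 := by
        have := exp_small (1 / 4); linarith
      calc |ka (n - 1) k x| ≤ Real.exp (1 / 4) * Real.exp (-(k * ((x + 1 : ℕ) / n)) / 4) := by
            refine h.trans ?_
            rw [← Real.exp_add]
            apply Real.exp_le_exp.2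
            push_cast
            have : (k : ℝ) * ((x + 1) / n) - k * x / (n - 1) ≤ 1 := by
              rw [← mul_div_assoc, div_sub_div _ _ (by linarith) (by linarith),
                div_le_one (mul_pos (by linarith) (by linarith))]
              nlinarith [mul_nonneg hk0 hx0]
            linarith
        _ ≤ _ := by gcongr
    have h0 : 0 ≤ 2 * ((x : ℝ) + 1) / n := by positivity
    rw [abs_of_nonneg h0]
    calc _ ≤ 2 * ((x : ℝ) + 1) / n * ((4 / 3) * Real.exp (-(k * ((x + 1 : ℕ) / n)) / 4)) := by
          gcongr
      _ = _ := by push_cast; ring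

lemma dm_sq {k n x : ℕ} (hk1 : 1 ≤ k) (hk : 2 * k ≤ n) (hx : 2 * x ≤ n) :
    dm n k x ^ 2 / k ≤ 384 * ((x / n) / (1 + k * (x / n)) ^ 2) := by
  set l : ℝ := (x : ℝ) / n with hl
  have hl0 : 0 ≤ l := by positivity
  have hkR : (0 : ℝ) < k := by exact_mod_cast hk1
  have hv : 0 ≤ k * l := by positivity
  have h1 : |dm n k x| ≤ 3 * (k * l) := by
    have a := ka_near hk hx
    have b := mu_near (x := x) hk
    have : dm n k x = (ka n k x - 1) - ((1 - (k : ℝ) / n) ^ x - 1) := by simp only [dm]; ring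
    rw [this]
    refine (abs_sub _ _).trans ?_
    linarith
  have h2 : |dm n k x| ≤ 128 / (1 + k * l) ^ 2 := by
    have a := ka_decay k n x hk hx
    have b := mu_le (x := x) hk
    have c := exp_quarter hv
    rw [mul_div_assoc] at a
    have b' : Real.exp (-(k * l)) ≤ Real.exp (-(k * l) / 4) := Real.exp_le_exp.2 (by linarith)
    have b0 : 0 ≤ (1 - (k : ℝ) / n) ^ x := by
      apply pow_nonneg
      rw [sub_nonneg]
      exact div_le_one_of_le₀ (by exact_mod_cast (by omega : k ≤ n)) (by positivity)
    have : |dm n k x| ≤ |ka n k x| + |(1 - (k : ℝ) / n) ^ x| := abs_sub _ _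
    rw [abs_of_nonneg b0] at this
    have e : 128 / (1 + k * l) ^ 2 = 64 / (1 + k * l) ^ 2 + 64 / (1 + k * l) ^ 2 := by ring
    rw [e]
    linarith
  rw [div_le_iff₀ hkR, ← sq_abs, pow_two]
  calc |dm n k x| * |dm n k x| ≤ 3 * (k * l) * (128 / (1 + k * l) ^ 2) :=
        mul_le_mul h1 h2 (abs_nonneg _) (by positivity)
    _ = _ := by ring

lemma dm_step {k n x : ℕ} (hk : 2 * (k + 1) ≤ n) (hx : 2 * x ≤ n) :
    k * (dm n (k + 1) x - dm n k x) ^ 2 ≤ 102400 * ((x / n) / (1 + k * (x / n)) ^ 2) := by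
  set l : ℝ := (x : ℝ) / n with hl
  have hl0 : 0 ≤ l := by positivity
  have hk0 : (0 : ℝ) ≤ k := Nat.cast_nonneg k
  have hv : 0 ≤ k * l := by positivity
  have h2 : |dm n (k + 1) x - dm n k x| ≤ 320 * l / (1 + k * l) ^ 2 := by
    have a := ka_step' hk hx
    have b := mu_step (x := x) hk
    have c := exp_quarter hv
    have b' : Real.exp (-(k * l)) ≤ Real.exp (-(k * l) / 4) := Real.exp_le_exp.2 (by linarith)
    have e : dm n (k + 1) x - dm n k x = (ka n (k + 1) x - ka n k x)
      - ((1 - ((k + 1 : ℕ) : ℝ) / n) ^ x - (1 - (k : ℝ) / n) ^ x) := by simp only [dm]; ring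
    rw [e]
    refine (abs_sub _ _).trans ((add_le_add a b).trans ?_)
    rw [← hl]
    calc (8 / 3) * l * Real.exp (-(k * l) / 4) + 2 * l * Real.exp (-(k * l))
        ≤ (8 / 3) * l * (64 / (1 + k * l) ^ 2) + 2 * l * (64 / (1 + k * l) ^ 2) := by
          have := b'.trans c
          gcongr
      _ = (896 / 3) * l / (1 + k * l) ^ 2 := by ring
      _ ≤ _ := by gcongr; norm_num
  have h3 : (dm n (k + 1) x - dm n k x) ^ 2 ≤ (320 * l / (1 + k * l) ^ 2) ^ 2 := by
    rw [← sq_abs]; exact pow_le_pow_left₀ (abs_nonneg _) h2 2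
  calc k * (dm n (k + 1) x - dm n k x) ^ 2 ≤ k * (320 * l / (1 + k * l) ^ 2) ^ 2 := by gcongr
    _ = 102400 * (l / (1 + k * l) ^ 2) * ((k * l) / (1 + k * l) ^ 2) := by field_simp; ring
    _ ≤ 102400 * (l / (1 + k * l) ^ 2) * 1 := by
        gcongr
        rw [div_le_one (by positivity)]; nlinarith
    _ = _ := mul_one _

lemma tele {l : ℝ} (hl : 0 ≤ l) (N : ℕ) :
    ∑ k ∈ Finset.Ico 1 N, l / (1 + k * l) ^ 2 ≤ 1 := by
  have h : ∀ N : ℕ, ∑ k ∈ Finset.range N, l / (1 + ((k + 1 : ℕ) : ℝ) * l) ^ 2 ≤ 1 - 1 / (1 + N * l) := by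
    intro N
    induction N with
    | zero => simp
    | succ N ih =>
      rw [Finset.sum_range_succ]
      have hN : (0 : ℝ) ≤ N := Nat.cast_nonneg N
      have hNl : 0 ≤ N * l := by positivity
      have : l / (1 + ((N + 1 : ℕ) : ℝ) * l) ^ 2 ≤ 1 / (1 + N * l) - 1 / (1 + ((N + 1 : ℕ) : ℝ) * l) := by
        push_cast
        have p1 : 0 < 1 + N * l := by positivity
        have p2 : 0 < 1 + (N + 1) * l := by positivity
        rw [div_sub_div _ _ p1.ne' p2.ne', div_le_div_iff₀ (by positivity) (by positivity)]
        have : 1 * (1 + (N + 1) * l) - (1 + N * l) * 1 = l := by ring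
        rw [this, pow_two]
        apply mul_le_mul_of_nonneg_left _ hl
        apply mul_le_mul_of_nonneg_right _ p2.le
        linarith
      linarith
  rcases Nat.lt_or_ge N 1 with h0 | h0
  · have : N = 0 := by omega
    subst this; simp
  · obtain ⟨M, rfl⟩ : ∃ M, N = M + 1 := ⟨N - 1, by omega⟩
    rw [Finset.sum_Ico_eq_sum_range]
    have h1 := h M
    have : 0 ≤ 1 / (1 + M * l) := by positivity
    simp only [Nat.add_sub_cancel]
    simp only [add_comm 1 _] at h1 ⊢
    linarith

lemma mult_sum {n x : ℕ} (hx : 2 * x ≤ n) :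
    ∑ k ∈ Finset.Ico 1 (n / 2), (k * (dm n (k + 1) x - dm n k x) ^ 2
      + (dm n k x ^ 2 + dm n (k + 1) x ^ 2) / (2 * k)) ≤ 103000 := by
  set l : ℝ := (x : ℝ) / n with hl
  have hl0 : 0 ≤ l := by positivity
  calc _ ≤ ∑ k ∈ Finset.Ico 1 (n / 2), 103000 * (l / (1 + k * l) ^ 2) := by
        apply Finset.sum_le_sum
        intro k hk
        rw [Finset.mem_Ico] at hk
        have h1 := dm_step (k := k) (n := n) (x := x) (by omega) hx
        have h2 := dm_sq (k := k) (n := n) (x := x) (by omega) (by omega) hx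
        have h3 := dm_sq (k := k + 1) (n := n) (x := x) (by omega) (by omega) hx
        rw [← hl] at h1 h2 h3
        have hk1 : (1 : ℝ) ≤ k := by exact_mod_cast hk.1
        have h4 : dm n (k + 1) x ^ 2 / (2 * k) ≤ dm n (k + 1) x ^ 2 / ((k + 1 : ℕ) : ℝ) := by
          gcongr
          push_cast; linarith
        have h5 : l / (1 + ((k + 1 : ℕ) : ℝ) * l) ^ 2 ≤ l / (1 + k * l) ^ 2 := by
          gcongr
          push_cast; linarith
        have h6 : dm n k x ^ 2 / (2 * k) = (1 / 2) * (dm n k x ^ 2 / k) := by field_simp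
        have h7 : 0 ≤ l / (1 + k * l) ^ 2 := by positivity
        rw [add_div]
        linarith
    _ ≤ 103000 * 1 := by
        rw [← Finset.mul_sum]
        exact mul_le_mul_of_nonneg_left (tele hl0 _) (by norm_num)
    _ = _ := by norm_num

end SphVar

namespace SphVar

/-- pointwise xor -/
def xr {n : ℕ} (x w : Fin n → Bool) : Fin n → Bool := fun i => xor (x i) (w i)

lemma xr_xr {n : ℕ} (x w : Fin n → Bool) : xr (xr x w) w = x := by
  funext i; simp [xr]

lemma xr_comm {n : ℕ} (x w : Fin n → Bool) : xr x w = xr w x := by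
  funext i; simp [xr, Bool.xor_comm]

lemma xr_assoc {n : ℕ} (x w v : Fin n → Bool) : xr (xr x w) v = xr x (xr w v) := by
  funext i; simp [xr]

/-- translation as an equivalence -/
def xrE {n : ℕ} (w : Fin n → Bool) : (Fin n → Bool) ≃ (Fin n → Bool) where
  toFun x := xr x w
  invFun x := xr x w
  left_inv x := xr_xr x w
  right_inv x := xr_xr x w

lemma sum_xr {n : ℕ} {β : Type*} [AddCommMonoid β] (w : Fin n → Bool) (F : (Fin n → Bool) → β) :
    ∑ x, F (xr x w) = ∑ x, F x := Equiv.sum_comp (xrE w) F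

lemma sum_prod_pi {n : ℕ} {α R : Type*} [Fintype α] [CommSemiring R] (h : Fin n → α → R) :
    ∑ x : Fin n → α, ∏ i, h i (x i) = ∏ i, ∑ b, h i b := by
  classical
  rw [Finset.prod_univ_sum, Fintype.piFinset_univ]

/-- real characters -/
noncomputable def chR {n : ℕ} (y x : Fin n → Bool) : ℝ :=
  ∏ i, (if x i = true ∧ y i = true then (-1 : ℝ) else 1)

lemma chi_eq {n : ℕ} (y x : Fin n → Bool) : chi y x = (chR y x : ℂ) := by
  rw [chi, chR, Finset.prod_ite, Finset.prod_const, Finset.prod_const_one, mul_one]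
  push_cast
  rfl

lemma chR_symm {n : ℕ} (y x : Fin n → Bool) : chR y x = chR x y := by
  simp only [chR, and_comm]

lemma chR_xr {n : ℕ} (y x w : Fin n → Bool) : chR y (xr x w) = chR y x * chR y w := by
  simp only [chR, ← Finset.prod_mul_distrib]
  apply Finset.prod_congr rfl
  intro i _
  rcases hx : x i <;> rcases hw : w i <;> rcases hy : y i <;> simp [xr, hx, hw]

lemma chR_orth {n : ℕ} (y y' : Fin n → Bool) :
    ∑ x, chR y x * chR y' x = if y = y' then (2 : ℝ) ^ n else 0 := by
  simp only [chR, ← Finset.prod_mul_distrib]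
  rw [sum_prod_pi (fun i b => (if b = true ∧ y i = true then (-1 : ℝ) else 1)
    * (if b = true ∧ y' i = true then (-1 : ℝ) else 1))]
  have : ∀ i, ∑ b : Bool, (if b = true ∧ y i = true then (-1 : ℝ) else 1)
    * (if b = true ∧ y' i = true then (-1 : ℝ) else 1) = if y i = y' i then 2 else 0 := by
    intro i
    rcases y i <;> rcases y' i <;> norm_num
  simp only [this]
  split_ifs with h
  · subst h; simp
  · obtain ⟨i, hi⟩ := Function.ne_iff.1 h
    exact Finset.prod_eq_zero (Finset.mem_univ i) (by simp [hi])

lemma chC_orth {n : ℕ} (y y' : Fin n → Bool) :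
    ∑ x, (chR y x : ℂ) * (chR y' x : ℂ) = if y = y' then (2 : ℂ) ^ n else 0 := by
  have h2 := congrArg (fun r : ℝ => (r : ℂ)) (chR_orth y y')
  simp only [Complex.ofReal_sum, Complex.ofReal_mul] at h2
  rw [h2]
  split_ifs <;> simp

/-- Fourier coefficients -/
noncomputable def cf {n : ℕ} (f : (Fin n → Bool) → ℂ) (y : Fin n → Bool) : ℂ :=
  ((2 : ℂ) ^ n)⁻¹ * ∑ z, f z * (chR y z : ℂ)

lemma inversion {n : ℕ} (f : (Fin n → Bool) → ℂ) (x : Fin n → Bool) :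
    f x = ∑ y, cf f y * (chR y x : ℂ) := by
  simp only [cf, mul_assoc, Finset.sum_mul]
  rw [← Finset.mul_sum, Finset.sum_comm]
  simp only [← Finset.mul_sum]
  have : ∀ z, ∑ y, (chR y z : ℂ) * (chR y x : ℂ) = if z = x then (2 : ℂ) ^ n else 0 := by
    intro z
    simp only [chR_symm _ z, chR_symm _ x]
    exact chC_orth z x
  simp only [this]
  simp
  field_simp

lemma parseval {n : ℕ} (c : (Fin n → Bool) → ℂ) :
    ∑ x, ‖∑ y, c y * (chR y x : ℂ)‖ ^ 2 = 2 ^ n * ∑ y, ‖c y‖ ^ 2 := by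
  have key : ((∑ x, ‖∑ y, c y * (chR y x : ℂ)‖ ^ 2 : ℝ) : ℂ)
      = ((2 ^ n * ∑ y, ‖c y‖ ^ 2 : ℝ) : ℂ) := by
    push_cast
    simp only [← Complex.mul_conj', map_sum, map_mul, Complex.conj_ofReal]
    simp only [Finset.sum_mul_sum]
    rw [Finset.sum_comm]
    rw [Finset.mul_sum]
    apply Finset.sum_congr rfl
    intro y _
    rw [Finset.sum_comm]
    have : ∀ y', ∑ x, c y * (chR y x : ℂ) * ((starRingEnd ℂ) (c y') * (chR y' x : ℂ))
        = c y * (starRingEnd ℂ) (c y') * (if y = y' then (2 : ℂ) ^ n else 0) := by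
      intro y'
      rw [← chC_orth, Finset.mul_sum]
      apply Finset.sum_congr rfl
      intro x _; ring
    simp only [this]
    simp
    ring
  exact_mod_cast key

lemma cf_zero {n : ℕ} {f : (Fin n → Bool) → ℂ} {y : Fin n → Bool} (h : fourierT f y = 0) :
    cf f y = 0 := by
  simp only [fourierT, chi_eq] at h
  rw [mul_eq_zero] at h
  rcases h with h | h
  · exfalso
    rw [inv_eq_zero] at h
    have : Real.sqrt (2 ^ n) = 0 := by exact_mod_cast h
    have h2 : 0 < Real.sqrt (2 ^ n) := Real.sqrt_pos.2 (by positivity)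
    linarith
  · simp [cf, h]

section kraw
open Polynomial

lemma kraw_gen {n : ℕ} (y : Fin n → Bool) :
    ∑ w : Fin n → Bool, C (chR y w) * X ^ (wt w) = KG n (wt y) := by
  have e : ∀ w : Fin n → Bool, (C (chR y w) * X ^ (wt w) : ℝ[X])
      = ∏ i, (if w i = true then (if y i = true then -X else X) else 1) := by
    intro w
    have e1 : (X ^ (wt w) : ℝ[X]) = ∏ i, (if w i = true then X else 1) := by
      rw [Finset.prod_ite, Finset.prod_const, Finset.prod_const_one, mul_one]; rfl
    rw [e1, chR, map_prod, ← Finset.prod_mul_distrib]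
    apply Finset.prod_congr rfl
    intro i _
    rcases w i <;> rcases y i <;> simp
  simp only [e]
  rw [sum_prod_pi (fun i b => (if b = true then (if y i = true then -X else X) else (1 : ℝ[X])))]
  have e2 : ∀ i, ∑ b : Bool, (if b = true then (if y i = true then -X else X) else (1 : ℝ[X]))
      = if y i = true then 1 - X else 1 + X := by
    intro i; rcases y i <;> simp <;> ring
  simp only [e2]
  rw [Finset.prod_ite, Finset.prod_const, Finset.prod_const, KG]
  congr 2
  have := Finset.card_filter_add_card_filter_not (s := (Finset.univ : Finset (Fin n)))
    (fun i => y i = true)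
  simp only [Finset.card_univ, Fintype.card_fin] at this
  simp only [wt]; omega

lemma kraw_sum {n : ℕ} (k : ℕ) (y : Fin n → Bool) :
    ∑ w : Fin n → Bool with wt w = k, chR y w = Kr n k (wt y) := by
  rw [Kr, ← kraw_gen, finsetSum_coeff, Finset.sum_filter]
  apply Finset.sum_congr rfl
  intro w _
  rw [coeff_C_mul, coeff_X_pow]
  by_cases h : wt w = k
  · simp [h]
  · simp [h, Ne.symm h]

end kraw

lemma hamming_wt {n : ℕ} (x w : Fin n → Bool) : hammingDist x (xr w x) = wt w := by
  simp only [hammingDist, wt]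
  congr 1
  ext i
  rw [Finset.mem_filter, Finset.mem_filter]
  simp only [Finset.mem_univ, true_and, xr]
  rcases x i <;> rcases w i <;> simp

lemma sph_conv {n : ℕ} (k : ℕ) (f : (Fin n → Bool) → ℂ) (x : Fin n → Bool) :
    sphMean n k f x = ((n.choose k : ℂ))⁻¹ * ∑ w : Fin n → Bool with wt w = k, f (xr x w) := by
  unfold sphMean
  congr 1
  rw [Finset.sum_filter, Finset.sum_filter, ← sum_xr x]
  apply Finset.sum_congr rfl
  intro w _
  rw [hamming_wt, xr_comm w x]

lemma sph_fourier {n : ℕ} (k : ℕ) (f : (Fin n → Bool) → ℂ) (x : Fin n → Bool) :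
    sphMean n k f x = ∑ y, cf f y * (ka n k (wt y) : ℂ) * (chR y x : ℂ) := by
  rw [sph_conv]
  have : ∀ w, f (xr x w) = ∑ y, cf f y * ((chR y x : ℂ) * (chR y w : ℂ)) := by
    intro w
    rw [inversion f (xr x w)]
    apply Finset.sum_congr rfl
    intro y _
    rw [chR_xr]; push_cast; ring
  simp only [this]
  rw [Finset.sum_comm, Finset.mul_sum]
  apply Finset.sum_congr rfl
  intro y _
  simp only [← Finset.mul_sum]
  rw [ka, ← kraw_sum]
  push_cast
  ring

/-- masked increment -/
def mask {n : ℕ} (u : Fin n → Fin n) (l : ℕ) (z : Fin n → Bool) : Fin n → Bool :=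
  fun i => if (u i : ℕ) < l then false else z i

lemma mask_xr {n : ℕ} (u : Fin n → Fin n) {i l : ℕ} (h : i ≤ l) (z' z : Fin n → Bool) :
    mask u i (xr z' (mask u l z)) = xr (mask u i z') (mask u l z) := by
  funext j
  simp only [mask, xr]
  by_cases h1 : (u j : ℕ) < i
  · have h2 : (u j : ℕ) < l := by omega
    simp [h1, h2]
  · simp [h1]

lemma mask_mask {n : ℕ} (u : Fin n → Fin n) {i l : ℕ} (h : i ≤ l) (z : Fin n → Bool) :
    mask u i (mask u l z) = mask u l z := by
  funext j
  simp only [mask]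
  by_cases h1 : (u j : ℕ) < i
  · have h2 : (u j : ℕ) < l := by omega
    simp [h2]
  · simp [h1]

/-- the martingale -/
noncomputable def mg {n : ℕ} (u : Fin n → Fin n) (f : (Fin n → Bool) → ℂ) (x : Fin n → Bool)
    (l : ℕ) : ℂ := ((2 : ℂ) ^ n)⁻¹ * ∑ z, f (xr x (mask u l z))

lemma mg_inv {n : ℕ} (u : Fin n → Fin n) (f : (Fin n → Bool) → ℂ) (x z : Fin n → Bool)
    {i l : ℕ} (h : i ≤ l) : mg u f (xr x (mask u l z)) i = mg u f x i := by
  simp only [mg]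
  congr 1
  rw [← sum_xr (mask u l z) (fun z' => f (xr x (mask u i z')))]
  apply Finset.sum_congr rfl
  intro z' _
  rw [mask_xr u h, xr_assoc, xr_comm (mask u l z)]

lemma mg_last {n : ℕ} (u : Fin n → Fin n) (f : (Fin n → Bool) → ℂ) (x : Fin n → Bool) :
    mg u f x n = f x := by
  have : ∀ z, xr x (mask u n z) = x := by
    intro z; funext i; simp [xr, mask]
  simp only [mg, this]
  simp

lemma mg_orth {n : ℕ} (u : Fin n → Fin n) (f H : (Fin n → Bool) → ℂ) (l : ℕ)
    (hH : ∀ x z, H (xr x (mask u l z)) = H x) :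
    ∑ x, H x * mg u f x l = ∑ x, H x * f x := by
  simp only [mg]
  have : ∀ x, H x * (((2 : ℂ) ^ n)⁻¹ * ∑ z, f (xr x (mask u l z)))
      = ((2 : ℂ) ^ n)⁻¹ * ∑ z, H (xr x (mask u l z)) * f (xr x (mask u l z)) := by
    intro x
    simp only [hH, ← Finset.mul_sum]; ring
  simp only [this]
  rw [← Finset.mul_sum, Finset.sum_comm]
  have : ∀ z, ∑ x, H (xr x (mask u l z)) * f (xr x (mask u l z)) = ∑ x, H x * f x := fun z =>
    sum_xr (mask u l z) (fun x => H x * f x)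
  simp only [this]
  simp

lemma mg_diff {n : ℕ} (u : Fin n → Fin n) (f H : (Fin n → Bool) → ℂ) (l : ℕ)
    (hH : ∀ x z, H (xr x (mask u l z)) = H x) :
    ∑ x, (H x * (mg u f x (l + 1) - mg u f x l)).re = 0 := by
  rw [← Complex.re_sum]
  simp only [mul_sub, Finset.sum_sub_distrib]
  rw [mg_orth u f H l hH, mg_orth u f H (l + 1)]
  · simp
  · intro x z
    rw [← mask_mask u (Nat.le_succ l), hH]

lemma mg_Q {n : ℕ} (u : Fin n → Fin n) (f : (Fin n → Bool) → ℂ) (ε : ℝ) :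
    ∑ x, Qv ε (mg u f x) n ≤ ∑ x, ‖f x‖ ^ 2 := by
  refine (Finset.sum_le_sum (fun x _ => Qv_le ε (mg u f x) n)).trans ?_
  rw [Finset.sum_sub_distrib, ← Finset.mul_sum, Finset.sum_comm]
  have : ∀ i, ∑ x, ((starRingEnd ℂ) (sg ε (mg u f x) i) * (mg u f x (i + 1) - mg u f x i)).re = 0 := by
    intro i
    apply mg_diff u f (fun x => (starRingEnd ℂ) (sg ε (mg u f x) i)) i
    intro x z
    rw [sg_congr (fun j hj => mg_inv u f x z hj)]
  simp only [this, mg_last]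
  simp

lemma mg_M {n : ℕ} (u : Fin n → Fin n) (f : (Fin n → Bool) → ℂ) :
    ∑ x, Mx (mg u f x) n ^ 2 ≤ 4 * ∑ x, ‖f x‖ ^ 2 := by
  refine (Finset.sum_le_sum (fun x _ => doob_path (mg u f x) n)).trans ?_
  rw [Finset.sum_sub_distrib, ← Finset.mul_sum, ← Finset.mul_sum, Finset.sum_comm]
  have : ∀ i, ∑ x, ((starRingEnd ℂ) (dr (mg u f x) i) * (mg u f x (i + 1) - mg u f x i)).re = 0 := by
    intro i
    apply mg_diff u f (fun x => (starRingEnd ℂ) (dr (mg u f x) i)) i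
    intro x z
    rw [dr_congr (fun j hj => mg_inv u f x z hj)]
  simp only [this, mg_last]
  simp

lemma mg_L {r : ℝ} (hr : 2 < r) {n : ℕ} (u : Fin n → Fin n) (f : (Fin n → Bool) → ℂ) :
    ∑ x, Lf r n (mg u f x) ≤ (8 + (1 - (1 / 2 : ℝ) ^ (r - 2))⁻¹) * ∑ x, ‖f x‖ ^ 2 := by
  set q : ℝ := (1 / 2 : ℝ) ^ (r - 2) with hq
  have hq0 : 0 ≤ q := by positivity
  have hq1 : q < 1 := Real.rpow_lt_one (by norm_num) (by norm_num) (by linarith)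
  have hF : 0 ≤ ∑ x, ‖f x‖ ^ 2 := Finset.sum_nonneg (fun _ _ => by positivity)
  simp only [Lf, ← hq]
  rw [Finset.sum_add_distrib, ← Finset.mul_sum, Finset.sum_comm]
  have h1 := mg_M u f
  have h2 : ∑ m ∈ Finset.range (n + 1), ∑ x, q ^ m * Qv ((1 / 2) ^ m) (mg u f x) n
      ≤ (1 - q)⁻¹ * ∑ x, ‖f x‖ ^ 2 := by
    calc _ ≤ ∑ m ∈ Finset.range (n + 1), q ^ m * ∑ x, ‖f x‖ ^ 2 := by
          apply Finset.sum_le_sum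
          intro m _
          rw [← Finset.mul_sum]
          exact mul_le_mul_of_nonneg_left (mg_Q u f _) (by positivity)
      _ = (∑ m ∈ Finset.range (n + 1), q ^ m) * ∑ x, ‖f x‖ ^ 2 := by rw [Finset.sum_mul]
      _ ≤ _ := by
          apply mul_le_mul_of_nonneg_right _ hF
          rw [← tsum_geometric_of_lt_one hq0 hq1]
          exact (summable_geometric_of_lt_one hq0 hq1).sum_le_tsum _ (fun _ _ => by positivity)
  linarith

lemma avg_chR {n : ℕ} {l : ℕ} (hl : l ≤ n) (y : Fin n → Bool) :
    ∑ u : Fin n → Fin n, ∑ z, chR y (mask u l z) = (2 : ℝ) ^ n * n ^ n * ((l : ℝ) / n) ^ (wt y) := by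
  have e1 : ∀ u : Fin n → Fin n, ∑ z, chR y (mask u l z)
      = ∏ i, ∑ b : Bool, (if (if (u i : ℕ) < l then false else b) = true ∧ y i = true
        then (-1 : ℝ) else 1) := by
    intro u
    rw [← sum_prod_pi (fun i b => (if (if (u i : ℕ) < l then false else b) = true ∧ y i = true
        then (-1 : ℝ) else 1))]
    rfl
  simp only [e1]
  rw [sum_prod_pi (fun i (j : Fin n) => ∑ b : Bool, (if (if (j : ℕ) < l then false else b) = true
    ∧ y i = true then (-1 : ℝ) else 1))]
  have e2 : ∀ i, ∑ j : Fin n, ∑ b : Bool, (if (if (j : ℕ) < l then false else b) = true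
    ∧ y i = true then (-1 : ℝ) else 1) = 2 * n * (if y i = true then (l : ℝ) / n else 1) := by
    intro i
    have hn : (n : ℝ) ≠ 0 := by
      have := i.pos
      positivity
    rcases y i
    · simp; ring
    · have : ∀ j : Fin n, ∑ b : Bool, (if (if (j : ℕ) < l then false else b) = true
        ∧ true = true then (-1 : ℝ) else 1) = if (j : ℕ) < l then 2 else 0 := by
        intro j
        by_cases h : (j : ℕ) < l <;> simp [h] <;> norm_num
      rw [Finset.sum_congr rfl (fun j _ => this j)]
      rw [← Finset.sum_filter, Finset.sum_const, Fin.card_filter_val_lt, min_eq_right hl]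
      simp
      field_simp
  simp only [e2]
  rw [Finset.prod_mul_distrib, Finset.prod_const, Finset.prod_ite, Finset.prod_const,
    Finset.prod_const_one, mul_one, Finset.card_univ, Fintype.card_fin, mul_pow]
  rfl

lemma mg_fourier {n : ℕ} (u : Fin n → Fin n) (l : ℕ) (f : (Fin n → Bool) → ℂ) (x : Fin n → Bool) :
    mg u f x l = ((2 : ℂ) ^ n)⁻¹ * ∑ y, cf f y * (chR y x : ℂ) * ((∑ z, chR y (mask u l z) : ℝ) : ℂ) := by
  simp only [mg]
  congr 1
  have : ∀ w, f (xr x w) = ∑ y, cf f y * (chR y x : ℂ) * (chR y w : ℂ) := by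
    intro w
    rw [inversion f (xr x w)]
    apply Finset.sum_congr rfl
    intro y _
    rw [chR_xr]; push_cast; ring
  simp only [this]
  rw [Finset.sum_comm]
  apply Finset.sum_congr rfl
  intro y _
  rw [← Finset.mul_sum]; push_cast; rfl

lemma avg_fourier {n : ℕ} (hn : 0 < n) {l : ℕ} (hl : l ≤ n) (f : (Fin n → Bool) → ℂ)
    (x : Fin n → Bool) :
    ((n : ℂ) ^ n)⁻¹ * ∑ u : Fin n → Fin n, mg u f x l
      = ∑ y, cf f y * ((((l : ℝ) / n) ^ (wt y) : ℝ) : ℂ) * (chR y x : ℂ) := by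
  simp only [mg_fourier]
  rw [← Finset.mul_sum, Finset.sum_comm]
  simp only [← Finset.mul_sum]
  have : ∀ y : Fin n → Bool, ∑ u : Fin n → Fin n, ((∑ z, chR y (mask u l z) : ℝ) : ℂ)
      = (((2 : ℝ) ^ n * n ^ n * ((l : ℝ) / n) ^ (wt y) : ℝ) : ℂ) := by
    intro y
    rw [← avg_chR hl y]; push_cast; rfl
  simp only [this]
  rw [Finset.mul_sum, Finset.mul_sum]
  apply Finset.sum_congr rfl
  intro y _
  have hn' : (n : ℂ) ≠ 0 := by exact_mod_cast hn.ne'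
  push_cast
  field_simp

end SphVar

namespace SphVar

/-- finite `ℓ^r` norm -/
noncomputable def Nr (r : ℝ) {J : ℕ} (v : Fin J → ℂ) : ℝ := (∑ j, ‖v j‖ ^ r) ^ (1 / r)

lemma Nr_nonneg (r : ℝ) {J : ℕ} (v : Fin J → ℂ) : 0 ≤ Nr r v := by
  unfold Nr
  exact Real.rpow_nonneg (Finset.sum_nonneg (fun _ _ => by positivity)) _

lemma Nr_add {r : ℝ} (hr : 1 ≤ r) {J : ℕ} (v w : Fin J → ℂ) :
    Nr r (fun j => v j + w j) ≤ Nr r v + Nr r w := by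
  unfold Nr
  refine le_trans ?_ (Real.Lp_add_le_of_nonneg Finset.univ hr (f := fun j => ‖v j‖)
    (g := fun j => ‖w j‖) (fun _ _ => norm_nonneg _) (fun _ _ => norm_nonneg _))
  apply Real.rpow_le_rpow (Finset.sum_nonneg (fun _ _ => by positivity)) _ (by positivity)
  apply Finset.sum_le_sum
  intro j _
  exact Real.rpow_le_rpow (norm_nonneg _) (norm_add_le _ _) (by linarith)

lemma Nr_smul {r : ℝ} (hr : 1 ≤ r) {J : ℕ} (c : ℂ) (v : Fin J → ℂ) :
    Nr r (fun j => c * v j) = ‖c‖ * Nr r v := by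
  unfold Nr
  simp only [norm_mul]
  have : ∀ j, (‖c‖ * ‖v j‖) ^ r = ‖c‖ ^ r * ‖v j‖ ^ r := fun j =>
    Real.mul_rpow (norm_nonneg _) (norm_nonneg _)
  simp only [this]
  rw [← Finset.mul_sum, Real.mul_rpow (by positivity)
    (Finset.sum_nonneg (fun _ _ => by positivity)), ← Real.rpow_mul (norm_nonneg _),
    mul_one_div_cancel (by linarith), Real.rpow_one]

lemma Nr_sum {r : ℝ} (hr : 1 ≤ r) {J : ℕ} {ι : Type*} (s : Finset ι) (v : ι → Fin J → ℂ) :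
    Nr r (fun j => ∑ i ∈ s, v i j) ≤ ∑ i ∈ s, Nr r (v i) := by
  classical
  induction s using Finset.induction_on with
  | empty =>
    have hr0 : r ≠ 0 := by linarith
    simp [Nr, Real.zero_rpow hr0, Real.zero_rpow (inv_ne_zero hr0)]
  | insert a s ha ih =>
    simp only [Finset.sum_insert ha]
    exact (Nr_add hr _ _).trans (by linarith)

lemma fin_tele {J : ℕ} (g : Fin (J + 1) → ℝ) :
    ∑ j : Fin J, (g j.succ - g j.castSucc) = g (Fin.last J) - g 0 := by
  induction J with
  | zero => simp
  | succ J ih =>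
    rw [Fin.sum_univ_castSucc]
    have := ih (fun j => g j.castSucc)
    simp only [Fin.castSucc_zero] at this
    simp only [Fin.succ_castSucc] at *
    rw [this, Fin.succ_last]
    ring

lemma Nr_mg {r : ℝ} (hr : 2 < r) (n : ℕ) (a : ℕ → ℂ) {J : ℕ} (t : Fin (J + 1) → ℕ)
    (ht : StrictMono t) :
    Nr r (fun j : Fin J => a (n - t j.castSucc) - a (n - t j.succ))
      ≤ (64 * 4 ^ r) ^ (1 / r) * Real.sqrt (Lf r n a) := by
  have hL := Lf_nonneg r n a
  have h1 : ∑ j : Fin J, ‖a (n - t j.castSucc) - a (n - t j.succ)‖ ^ r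
      ≤ (64 * 4 ^ r) * Lf r n a ^ (r / 2) := by
    calc _ ≤ ∑ j : Fin J, ((fun i => - Psi r n a (n - t i)) j.succ
              - (fun i => - Psi r n a (n - t i)) j.castSucc) := by
          apply Finset.sum_le_sum
          intro j _
          have hj : t j.castSucc < t j.succ := ht (Fin.castSucc_lt_succ)
          have := jump_le_Psi hr n a (s := n - t j.succ) (t := n - t j.castSucc)
            (by omega) (by omega)
          linarith
      _ = - Psi r n a (n - t (Fin.last J)) - - Psi r n a (n - t 0) :=
          fin_tele (fun i => - Psi r n a (n - t i))
      _ ≤ Psi r n a n := by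
          have h2 := Psi_nonneg r n a (n - t (Fin.last J))
          have h3 := Psi_mono hr n a (s := n - t 0) (t := n) (by omega) le_rfl
          linarith
      _ ≤ _ := Psi_le hr n a
  unfold Nr
  refine (Real.rpow_le_rpow (Finset.sum_nonneg (fun _ _ => by positivity)) h1
    (by positivity)).trans (le_of_eq ?_)
  rw [Real.mul_rpow (by positivity) (by positivity), ← Real.rpow_mul hL, Real.sqrt_eq_rpow]
  congr 2
  field_simp

lemma real_sq (u v : ℝ) : (u - v) ^ 2 ≤ 2 * abs (u * |u| - v * |v|) := by
  rcases le_total 0 u with hu | hu <;> rcases le_total 0 v with hv | hv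
  · rw [abs_of_nonneg hu, abs_of_nonneg hv]
    rcases le_total u v with h | h
    · rw [abs_of_nonpos (by nlinarith)]; nlinarith
    · rw [abs_of_nonneg (by nlinarith)]; nlinarith
  · rw [abs_of_nonneg hu, abs_of_nonpos hv, abs_of_nonneg (by nlinarith)]
    nlinarith [sq_nonneg (u + v)]
  · rw [abs_of_nonpos hu, abs_of_nonneg hv, abs_of_nonpos (by nlinarith)]
    nlinarith [sq_nonneg (u + v)]
  · rw [abs_of_nonpos hu, abs_of_nonpos hv]
    rcases le_total u v with h | h
    · rw [abs_of_nonpos (by nlinarith)]; nlinarith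
    · rw [abs_of_nonneg (by nlinarith)]; nlinarith

lemma real_step (u v : ℝ) : abs (u * |u| - v * |v|) ≤ |u - v| * (|v| + |u|) := by
  have : u * |u| - v * |v| = (u - v) * |u| + v * (|u| - |v|) := by ring
  rw [this]
  refine (abs_add_le _ _).trans ?_
  rw [abs_mul, abs_mul, abs_abs]
  have := abs_abs_sub_abs_le u v
  nlinarith [abs_nonneg v]

lemma real_path (d : ℕ → ℝ) {s t : ℕ} (h : s ≤ t) :
    abs (d t * |d t| - d s * |d s|)
      ≤ ∑ k ∈ Finset.Ico s t, |d (k + 1) - d k| * (|d k| + |d (k + 1)|) := by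
  induction t, h using Nat.le_induction with
  | base => simp
  | succ t h ih =>
    rw [Finset.sum_Ico_succ_top h]
    have h1 := real_step (d (t + 1)) (d t)
    have h2 := abs_sub_le (d (t + 1) * |d (t + 1)|) (d t * |d t|) (d s * |d s|)
    linarith

lemma cplx_path (d : ℕ → ℂ) {s t : ℕ} (h : s ≤ t) :
    ‖d t - d s‖ ^ 2
      ≤ 4 * ∑ k ∈ Finset.Ico s t, ‖d (k + 1) - d k‖ * (‖d k‖ + ‖d (k + 1)‖) := by
  have h1 := (real_sq _ _).trans (mul_le_mul_of_nonneg_left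
    (real_path (fun k => (d k).re) h) (by norm_num : (0 : ℝ) ≤ 2))
  have h2 := (real_sq _ _).trans (mul_le_mul_of_nonneg_left
    (real_path (fun k => (d k).im) h) (by norm_num : (0 : ℝ) ≤ 2))
  have e : ‖d t - d s‖ ^ 2 = ((d t).re - (d s).re) ^ 2 + ((d t).im - (d s).im) ^ 2 := by
    rw [← Complex.normSq_eq_norm_sq, Complex.normSq_apply, Complex.sub_re, Complex.sub_im]; ring
  have h3 : ∑ k ∈ Finset.Ico s t, |(d (k + 1)).re - (d k).re| * (|(d k).re| + |(d (k + 1)).re|)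
      ≤ ∑ k ∈ Finset.Ico s t, ‖d (k + 1) - d k‖ * (‖d k‖ + ‖d (k + 1)‖) := by
    apply Finset.sum_le_sum
    intro k _
    rw [← Complex.sub_re]
    gcongr <;> exact Complex.abs_re_le_norm _
  have h4 : ∑ k ∈ Finset.Ico s t, |(d (k + 1)).im - (d k).im| * (|(d k).im| + |(d (k + 1)).im|)
      ≤ ∑ k ∈ Finset.Ico s t, ‖d (k + 1) - d k‖ * (‖d k‖ + ‖d (k + 1)‖) := by
    apply Finset.sum_le_sum
    intro k _
    rw [← Complex.sub_im]
    gcongr <;> exact Complex.abs_im_le_norm _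
  rw [e]
  linarith

/-- square function weight -/
noncomputable def wk (d : ℕ → ℂ) (k : ℕ) : ℝ :=
  4 * (k * ‖d (k + 1) - d k‖ ^ 2 + (‖d k‖ ^ 2 + ‖d (k + 1)‖ ^ 2) / (2 * k))

lemma wk_nonneg (d : ℕ → ℂ) (k : ℕ) : 0 ≤ wk d k := by unfold wk; positivity

/-- square function -/
noncomputable def Wf (d : ℕ → ℂ) (m : ℕ) : ℝ := ∑ k ∈ Finset.Ico 1 m, wk d k

lemma Wf_nonneg (d : ℕ → ℂ) (m : ℕ) : 0 ≤ Wf d m := Finset.sum_nonneg (fun _ _ => wk_nonneg d _)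

lemma Wf_mono (d : ℕ → ℂ) {s t : ℕ} (h : s ≤ t) : Wf d s ≤ Wf d t :=
  Finset.sum_le_sum_of_subset_of_nonneg (Finset.Ico_subset_Ico le_rfl h)
    (fun _ _ _ => wk_nonneg d _)

lemma jump_W (d : ℕ → ℂ) {s t : ℕ} (hs : 1 ≤ s) (h : s ≤ t) :
    ‖d s - d t‖ ^ 2 ≤ Wf d t - Wf d s := by
  have e : Wf d t - Wf d s = ∑ k ∈ Finset.Ico s t, wk d k := by
    unfold Wf
    rw [← Finset.sum_Ico_consecutive (wk d) hs h]; ring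
  rw [e, norm_sub_rev]
  refine (cplx_path d h).trans ?_
  rw [Finset.mul_sum]
  apply Finset.sum_le_sum
  intro k hk
  have hk1 : 1 ≤ k := hs.trans (Finset.mem_Ico.1 hk).1
  have hk0 : (0 : ℝ) < k := by exact_mod_cast hk1
  unfold wk
  apply mul_le_mul_of_nonneg_left _ (by norm_num)
  set a := ‖d (k + 1) - d k‖
  set b := ‖d k‖
  set c := ‖d (k + 1)‖
  have : k * a ^ 2 + (b ^ 2 + c ^ 2) / (2 * k) - a * (b + c)
      = ((2 * k * a - (b + c)) ^ 2 + (b - c) ^ 2) / (4 * k) := by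
    field_simp; ring
  have h2 : 0 ≤ ((2 * k * a - (b + c)) ^ 2 + (b - c) ^ 2) / (4 * k) := by positivity
  linarith

lemma Nr_W {r : ℝ} (hr : 2 < r) (d : ℕ → ℂ) {m J : ℕ} (t : Fin (J + 1) → ℕ)
    (ht : StrictMono t) (hm : ∀ j, t j ∈ Set.Icc 1 m) :
    Nr r (fun j : Fin J => d (t j.castSucc) - d (t j.succ)) ≤ Real.sqrt (Wf d m) := by
  set v := fun j : Fin J => d (t j.castSucc) - d (t j.succ) with hv
  have hW := Wf_nonneg d m
  have hs : ∑ j, ‖v j‖ ^ 2 ≤ Wf d m := by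
    calc _ ≤ ∑ j : Fin J, ((fun i => Wf d (t i)) j.succ - (fun i => Wf d (t i)) j.castSucc) := by
          apply Finset.sum_le_sum
          intro j _
          exact jump_W d (hm _).1 (ht (Fin.castSucc_lt_succ)).le
      _ = Wf d (t (Fin.last J)) - Wf d (t 0) := fin_tele (fun i => Wf d (t i))
      _ ≤ _ := by
          have h1 := Wf_nonneg d (t 0)
          have h2 := Wf_mono d (hm (Fin.last J)).2
          linarith
  have hj : ∀ j, ‖v j‖ ^ r ≤ ‖v j‖ ^ 2 * Real.sqrt (Wf d m) ^ (r - 2) := by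
    intro j
    have h1 : ‖v j‖ ^ 2 ≤ Wf d m :=
      (Finset.single_le_sum (f := fun j => ‖v j‖ ^ 2) (fun _ _ => by positivity)
        (Finset.mem_univ j)).trans hs
    have h2 : ‖v j‖ ≤ Real.sqrt (Wf d m) := Real.le_sqrt_of_sq_le h1
    have e : ‖v j‖ ^ r = ‖v j‖ ^ 2 * ‖v j‖ ^ (r - 2) := by
      rw [← Real.rpow_natCast, ← Real.rpow_add' (norm_nonneg _) (by push_cast; linarith)]
      congr 1; push_cast; ring
    rw [e]
    exact mul_le_mul_of_nonneg_left
      (Real.rpow_le_rpow (norm_nonneg _) h2 (by linarith)) (by positivity)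
  have hsum : ∑ j, ‖v j‖ ^ r ≤ Real.sqrt (Wf d m) ^ r := by
    calc _ ≤ ∑ j, ‖v j‖ ^ 2 * Real.sqrt (Wf d m) ^ (r - 2) := Finset.sum_le_sum (fun j _ => hj j)
      _ = (∑ j, ‖v j‖ ^ 2) * Real.sqrt (Wf d m) ^ (r - 2) := by rw [Finset.sum_mul]
      _ ≤ Wf d m * Real.sqrt (Wf d m) ^ (r - 2) :=
          mul_le_mul_of_nonneg_right hs (by positivity)
      _ = Real.sqrt (Wf d m) ^ 2 * Real.sqrt (Wf d m) ^ (r - 2) := by rw [Real.sq_sqrt hW]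
      _ = _ := by
          rw [← Real.rpow_natCast, ← Real.rpow_add' (Real.sqrt_nonneg _) (by push_cast; linarith)]
          congr 1; push_cast; ring
  unfold Nr
  refine (Real.rpow_le_rpow (Finset.sum_nonneg (fun _ _ => by positivity)) hsum
    (by positivity)).trans (le_of_eq ?_)
  rw [← Real.rpow_mul (Real.sqrt_nonneg _), mul_one_div_cancel (by linarith), Real.rpow_one]

/-- averaged martingale -/
noncomputable def Av {n : ℕ} (f : (Fin n → Bool) → ℂ) (x : Fin n → Bool) (k : ℕ) : ℂ :=
  ((n : ℂ) ^ n)⁻¹ * ∑ u : Fin n → Fin n, mg u f x (n - k)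

/-- difference -/
noncomputable def Df {n : ℕ} (f : (Fin n → Bool) → ℂ) (x : Fin n → Bool) (k : ℕ) : ℂ :=
  sphMean n k f x - Av f x k

lemma Df_fourier {n : ℕ} (hn : 0 < n) {k : ℕ} (hk : k ≤ n) (f : (Fin n → Bool) → ℂ)
    (x : Fin n → Bool) :
    Df f x k = ∑ y, cf f y * (dm n k (wt y) : ℂ) * (chR y x : ℂ) := by
  unfold Df Av
  rw [avg_fourier hn (Nat.sub_le n k), sph_fourier, ← Finset.sum_sub_distrib]
  apply Finset.sum_congr rfl
  intro y _
  have hn' : (n : ℝ) ≠ 0 := by exact_mod_cast hn.ne'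
  have : (((n - k : ℕ) : ℝ) / n) = 1 - (k : ℝ) / n := by
    rw [Nat.cast_sub hk]; field_simp
  rw [this, dm]
  push_cast
  ring

lemma Df_sq {n : ℕ} (hn : 0 < n) {k : ℕ} (hk : k ≤ n) (f : (Fin n → Bool) → ℂ) :
    ∑ x, ‖Df f x k‖ ^ 2 = 2 ^ n * ∑ y, ‖cf f y‖ ^ 2 * dm n k (wt y) ^ 2 := by
  simp only [Df_fourier hn hk]
  rw [parseval (fun y => cf f y * (dm n k (wt y) : ℂ))]
  simp [mul_pow]

lemma Df_diff_sq {n : ℕ} (hn : 0 < n) {k : ℕ} (hk : k + 1 ≤ n) (f : (Fin n → Bool) → ℂ) :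
    ∑ x, ‖Df f x (k + 1) - Df f x k‖ ^ 2
      = 2 ^ n * ∑ y, ‖cf f y‖ ^ 2 * (dm n (k + 1) (wt y) - dm n k (wt y)) ^ 2 := by
  have : ∀ x, Df f x (k + 1) - Df f x k
      = ∑ y, (cf f y * ((dm n (k + 1) (wt y) - dm n k (wt y) : ℝ) : ℂ)) * (chR y x : ℂ) := by
    intro x
    rw [Df_fourier hn hk, Df_fourier hn (by omega), ← Finset.sum_sub_distrib]
    apply Finset.sum_congr rfl
    intro y _
    push_cast; ring
  simp only [this]
  rw [parseval]
  congr 1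
  apply Finset.sum_congr rfl
  intro y _
  rw [norm_mul, mul_pow, Complex.norm_real, Real.norm_eq_abs, sq_abs]

lemma cf_parseval {n : ℕ} (f : (Fin n → Bool) → ℂ) :
    2 ^ n * ∑ y, ‖cf f y‖ ^ 2 = ∑ x, ‖f x‖ ^ 2 := by
  rw [← parseval]
  apply Finset.sum_congr rfl
  intro x _
  rw [← inversion]

lemma W_total {n : ℕ} (hn : 0 < n) (f : (Fin n → Bool) → ℂ)
    (hf : ∀ y, n < 2 * wt y → cf f y = 0) :
    ∑ x, Wf (Df f x) (n / 2) ≤ 412000 * ∑ x, ‖f x‖ ^ 2 := by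
  have e : ∑ x, Wf (Df f x) (n / 2) = 2 ^ n * ∑ y, ‖cf f y‖ ^ 2 * (4 *
      ∑ k ∈ Finset.Ico 1 (n / 2), (k * (dm n (k + 1) (wt y) - dm n k (wt y)) ^ 2
        + (dm n k (wt y) ^ 2 + dm n (k + 1) (wt y) ^ 2) / (2 * k))) := by
    unfold Wf
    rw [Finset.sum_comm]
    simp only [Finset.mul_sum]
    conv_rhs => rw [Finset.sum_comm]
    apply Finset.sum_congr rfl
    intro k hk
    have hk2 := (Finset.mem_Ico.1 hk).2
    have h1 := Df_sq hn (k := k) (by omega) f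
    have h2 := Df_sq hn (k := k + 1) (by omega) f
    have h3 := Df_diff_sq hn (k := k) (by omega) f
    simp only [wk]
    calc _ = 4 * (k * ∑ x, ‖Df f x (k + 1) - Df f x k‖ ^ 2 +
          (∑ x, ‖Df f x k‖ ^ 2 + ∑ x, ‖Df f x (k + 1)‖ ^ 2) / (2 * k)) := by
          rw [← Finset.mul_sum, Finset.sum_add_distrib, ← Finset.mul_sum, ← Finset.sum_div,
            Finset.sum_add_distrib]
      _ = _ := by
          rw [h1, h2, h3]
          simp only [mul_add, Finset.mul_sum, ← Finset.sum_add_distrib, Finset.sum_div]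
          apply Finset.sum_congr rfl
          intro y _
          ring
  rw [e, ← cf_parseval, mul_left_comm]
  apply mul_le_mul_of_nonneg_left _ (by positivity)
  rw [Finset.mul_sum]
  apply Finset.sum_le_sum
  intro y _
  by_cases h : n < 2 * wt y
  · simp [hf y h]
  · have := mult_sum (n := n) (x := wt y) (by omega)
    rw [mul_comm (412000 : ℝ)]
    apply mul_le_mul_of_nonneg_left _ (by positivity)
    linarith

/-- pointwise majorant -/
noncomputable def Uf (r : ℝ) {n : ℕ} (f : (Fin n → Bool) → ℂ) (x : Fin n → Bool) : ℝ :=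
  2 * ((64 * 4 ^ r) ^ (1 / r)) ^ 2 * (((n : ℝ) ^ n)⁻¹ * ∑ u, Lf r n (mg u f x))
    + 2 * Wf (Df f x) (n / 2)

lemma Uf_nonneg (r : ℝ) {n : ℕ} (f : (Fin n → Bool) → ℂ) (x : Fin n → Bool) : 0 ≤ Uf r f x := by
  have h1 := Wf_nonneg (Df f x) (n / 2)
  have h2 : 0 ≤ ∑ u, Lf r n (mg u f x) := Finset.sum_nonneg (fun u _ => Lf_nonneg r n _)
  unfold Uf
  positivity

lemma Nr_S {r : ℝ} (hr : 2 < r) {n : ℕ} (f : (Fin n → Bool) → ℂ)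
    (x : Fin n → Bool) {J : ℕ} (t : Fin (J + 1) → ℕ)
    (ht : StrictMono t) (hm : ∀ j, t j ∈ Set.Icc 1 (n / 2)) :
    Nr r (fun j : Fin J => sphMean n (t j.castSucc) f x - sphMean n (t j.succ) f x)
      ≤ Real.sqrt (Uf r f x) := by
  have hr1 : 1 ≤ r := by linarith
  set K : ℝ := (64 * 4 ^ r) ^ (1 / r) with hK
  have hK0 : 0 ≤ K := by positivity
  have hn : 0 < n := by
    have := hm 0
    rw [Set.mem_Icc] at this
    omega
  have hN : (0 : ℝ) < (n : ℝ) ^ n := by positivity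
  have e : (fun j : Fin J => sphMean n (t j.castSucc) f x - sphMean n (t j.succ) f x)
      = fun j : Fin J => (Df f x (t j.castSucc) - Df f x (t j.succ)) + ((n : ℂ) ^ n)⁻¹ *
        ∑ u : Fin n → Fin n, (mg u f x (n - t j.castSucc) - mg u f x (n - t j.succ)) := by
    funext j
    simp only [Df, Av, Finset.sum_sub_distrib]; ring
  have h1 := Nr_W hr (Df f x) t ht hm
  have h2 : Nr r (fun j : Fin J => ((n : ℂ) ^ n)⁻¹ *
        ∑ u : Fin n → Fin n, (mg u f x (n - t j.castSucc) - mg u f x (n - t j.succ)))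
      ≤ ((n : ℝ) ^ n)⁻¹ * ∑ u : Fin n → Fin n, K * Real.sqrt (Lf r n (mg u f x)) := by
    rw [Nr_smul hr1]
    have : ‖((n : ℂ) ^ n)⁻¹‖ = ((n : ℝ) ^ n)⁻¹ := by simp
    rw [this]
    apply mul_le_mul_of_nonneg_left _ (by positivity)
    refine (Nr_sum hr1 _ _).trans ?_
    apply Finset.sum_le_sum
    intro u _
    exact Nr_mg hr n (mg u f x) t ht
  rw [← Finset.mul_sum] at h2
  set A := ∑ u : Fin n → Fin n, Real.sqrt (Lf r n (mg u f x)) with hA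
  have hA2 : A ^ 2 ≤ (n : ℝ) ^ n * ∑ u : Fin n → Fin n, Lf r n (mg u f x) := by
    have := sq_sum_le_card_mul_sum_sq (s := (Finset.univ : Finset (Fin n → Fin n)))
      (f := fun u => Real.sqrt (Lf r n (mg u f x)))
    simp only [Real.sq_sqrt (Lf_nonneg r n _)] at this
    simpa using this
  have h3 : (((n : ℝ) ^ n)⁻¹ * A) ^ 2 ≤ ((n : ℝ) ^ n)⁻¹ * ∑ u, Lf r n (mg u f x) := by
    calc _ = ((n : ℝ) ^ n)⁻¹ ^ 2 * A ^ 2 := by ring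
      _ ≤ ((n : ℝ) ^ n)⁻¹ ^ 2 * ((n : ℝ) ^ n * ∑ u : Fin n → Fin n, Lf r n (mg u f x)) :=
          mul_le_mul_of_nonneg_left hA2 (by positivity)
      _ = _ := by field_simp
  apply Real.le_sqrt_of_sq_le
  rw [e]
  have h4 := (Nr_add hr1 (fun j : Fin J => (Df f x (t j.castSucc) - Df f x (t j.succ)))
    (fun j : Fin J => ((n : ℂ) ^ n)⁻¹ *
        ∑ u : Fin n → Fin n, (mg u f x (n - t j.castSucc) - mg u f x (n - t j.succ)))).trans
    (add_le_add h1 h2)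
  refine (pow_le_pow_left₀ (Nr_nonneg _ _) h4 2).trans ?_
  have h5 := Real.sq_sqrt (Wf_nonneg (Df f x) (n / 2))
  have h6 := mul_le_mul_of_nonneg_left h3 (sq_nonneg K)
  unfold Uf
  rw [← hK]
  nlinarith [sq_nonneg (Real.sqrt (Wf (Df f x) (n / 2)) - ((n : ℝ) ^ n)⁻¹ * (K * A))]

/-- the final constant -/
noncomputable def Cc (r : ℝ) : ℝ :=
  2 * ((64 * 4 ^ r) ^ (1 / r)) ^ 2 * (8 + (1 - (1 / 2 : ℝ) ^ (r - 2))⁻¹) + 824000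

lemma Cc_pos {r : ℝ} (hr : 2 < r) : 0 < Cc r := by
  have hq1 : (1 / 2 : ℝ) ^ (r - 2) < 1 :=
    Real.rpow_lt_one (by norm_num) (by norm_num) (by linarith)
  have : 0 < 1 - (1 / 2 : ℝ) ^ (r - 2) := by linarith
  unfold Cc
  positivity

lemma U_total {r : ℝ} (hr : 2 < r) {n : ℕ} (hn : 0 < n) (f : (Fin n → Bool) → ℂ)
    (hf : ∀ y, n < 2 * wt y → cf f y = 0) :
    ∑ x, Uf r f x ≤ Cc r * ∑ x, ‖f x‖ ^ 2 := by
  have hN : (0 : ℝ) < (n : ℝ) ^ n := by positivity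
  have h1 : ((n : ℝ) ^ n)⁻¹ * ∑ x, ∑ u, Lf r n (mg u f x)
      ≤ (8 + (1 - (1 / 2 : ℝ) ^ (r - 2))⁻¹) * ∑ x, ‖f x‖ ^ 2 := by
    rw [Finset.sum_comm, inv_mul_le_iff₀ hN]
    refine (Finset.sum_le_sum (fun u _ => mg_L hr u f)).trans (le_of_eq ?_)
    simp
  have h2 := W_total hn f hf
  unfold Uf Cc
  rw [Finset.sum_add_distrib, ← Finset.mul_sum, ← Finset.mul_sum, ← Finset.mul_sum]
  have h3 := mul_le_mul_of_nonneg_left h1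
    (by positivity : (0 : ℝ) ≤ 2 * ((64 * 4 ^ r) ^ (1 / r)) ^ 2)
  linarith

lemma eVar_le {r : ℝ} (hr : 2 < r) {n : ℕ} (f : (Fin n → Bool) → ℂ) (x : Fin n → Bool) :
    eVar r (fun k => sphMean n k f x) (Set.Icc 1 (n / 2))
      ≤ ENNReal.ofReal (Real.sqrt (Uf r f x)) := by
  unfold eVar
  refine iSup_le fun J => iSup_le fun t => iSup_le fun ht => iSup_le fun hm => ?_
  have h := Nr_S hr f x t ht hm
  refine le_trans (le_of_eq ?_) (ENNReal.ofReal_le_ofReal h)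
  unfold Nr
  rw [one_div, ← ENNReal.ofReal_rpow_of_nonneg
    (Finset.sum_nonneg (fun _ _ => by positivity)) (by positivity),
    ENNReal.ofReal_sum_of_nonneg (fun _ _ => by positivity)]
  congr 1
  apply Finset.sum_congr rfl
  intro j _
  rw [ENNReal.ofReal_rpow_of_nonneg (norm_nonneg _) (by linarith)]

end SphVar


/-- Dimension-free `ℓ²` bound for the `r`-variation of spherical means over radii in
`{1,...,⌊n/2⌋}`, for functions whose Fourier transform vanishes for `|y| > n/2`. -/
theorem statement6 (r : ℝ) (hr : 2 < r) :
    ∃ C : ℝ, 0 < C ∧ ∀ (n : ℕ) (f : (Fin n → Bool) → ℂ),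
      (∀ y : Fin n → Bool, (n : ℝ) / 2 < (wt y : ℝ) → fourierT f y = 0) →
      eL2 (fun x => eVar r (fun k => sphMean n k f x) (Set.Icc 1 (n / 2))) ≤
        ENNReal.ofReal (C * l2Norm f) := by
  refine ⟨Real.sqrt (SphVar.Cc r), Real.sqrt_pos.2 (SphVar.Cc_pos hr), ?_⟩
  intro n f hf
  rcases Nat.eq_zero_or_pos n with hn | hn
  · subst hn
    have h0 : ∀ x, eVar r (fun k => sphMean 0 k f x) (Set.Icc 1 (0 / 2)) = 0 := by
      intro x
      rw [← nonpos_iff_eq_zero]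
      unfold eVar
      refine iSup_le fun J => iSup_le fun t => iSup_le fun ht => iSup_le fun hm => ?_
      exfalso
      have := hm 0
      rw [Set.mem_Icc] at this
      omega
    simp only [h0]
    simp [eL2]
  have hf' : ∀ y, n < 2 * wt y → SphVar.cf f y = 0 := by
    intro y hy
    apply SphVar.cf_zero
    apply hf
    have : (n : ℝ) < 2 * (wt y : ℝ) := by exact_mod_cast hy
    linarith
  have hU := SphVar.U_total hr hn f hf'
  have hF : 0 ≤ ∑ x, ‖f x‖ ^ 2 := Finset.sum_nonneg (fun _ _ => by positivity)
  have hC := (SphVar.Cc_pos hr).le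
  have h1 : ∑ x, eVar r (fun k => sphMean n k f x) (Set.Icc 1 (n / 2)) ^ (2 : ℝ)
      ≤ ENNReal.ofReal (SphVar.Cc r * ∑ x, ‖f x‖ ^ 2) := by
    refine le_trans ?_ (ENNReal.ofReal_le_ofReal hU)
    rw [ENNReal.ofReal_sum_of_nonneg (fun x _ => SphVar.Uf_nonneg r f x)]
    apply Finset.sum_le_sum
    intro x _
    refine (ENNReal.rpow_le_rpow (SphVar.eVar_le hr f x) (by norm_num)).trans (le_of_eq ?_)
    rw [ENNReal.ofReal_rpow_of_nonneg (Real.sqrt_nonneg _) (by norm_num), Real.rpow_two,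
      Real.sq_sqrt (SphVar.Uf_nonneg r f x)]
  unfold eL2
  refine (ENNReal.rpow_le_rpow h1 (by norm_num)).trans (le_of_eq ?_)
  rw [ENNReal.ofReal_rpow_of_nonneg (mul_nonneg hC hF) (by norm_num), l2Norm,
    ← Real.sqrt_mul hC, Real.sqrt_eq_rpow, one_div]
end

section
/- There exists a constant c > 0, independent of everything, such that for every n ∈ {1,2,3,...} and all k, x ∈ {0, 1, ..., ⌊n/2⌋}, one has |κ_k^{(n)}(x)| ≤ e^{−c·kx/n}. -/
/-- The normalized Krawtchouk polynomial `κ_k^{(n)}(x)`. -/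
noncomputable def kraw (n k x : ℕ) : ℝ :=
  ((n.choose k : ℝ))⁻¹ *
    ∑ j ∈ Finset.range (k + 1), (-1 : ℝ) ^ j * (x.choose j) * ((n - x).choose (k - j))

open Polynomial in
/-- Coefficient of `z^k` in `(1+z^2)^x (1+z)^s`. -/
def pairCoef : ℕ → ℕ → ℕ → ℕ
  | 0, s, k => s.choose k
  | (x+1), s, k => pairCoef x s k + if 2 ≤ k then pairCoef x s (k-2) else 0

lemma choose_two_step (n k : ℕ) (hk : 2 ≤ k) :
    n.choose k + n.choose (k-2) ≤ (n+2).choose k := by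
  obtain ⟨j, rfl⟩ := Nat.exists_eq_add_of_le' hk
  have h1 := Nat.choose_succ_succ (n+1) (j+1)
  have h2 := Nat.choose_succ_succ n (j+1)
  have h3 := Nat.choose_succ_succ n j
  simp only [Nat.succ_eq_add_one, add_assoc, Nat.reduceAdd] at *
  have : j + 2 - 2 = j := by omega
  rw [this]; omega

lemma pairCoef_le (x s : ℕ) : ∀ k, pairCoef x s k ≤ (2*x+s).choose k := by
  induction x with
  | zero => intro k; simp [pairCoef]
  | succ x ih =>
    intro k
    have e : 2*(x+1)+s = (2*x+s)+2 := by ring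
    rw [pairCoef, e]
    split_ifs with h
    · exact (add_le_add (ih k) (ih (k-2))).trans (choose_two_step _ _ h)
    · exact (ih k).trans (Nat.choose_le_choose k (by omega))

lemma pairCoef_zero (x s k : ℕ) (h : 2*x+s < k) : pairCoef x s k = 0 := by
  have := pairCoef_le x s k
  rw [Nat.choose_eq_zero_of_lt h] at this
  omega

lemma pairCoef_symm (x s : ℕ) : ∀ k l, k + l = 2*x+s → pairCoef x s k = pairCoef x s l := by
  induction x with
  | zero => intro k l h; simp only [pairCoef]; exact Nat.choose_symm_of_eq_add (by omega)
  | succ x ih =>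
    intro k l h
    have key : ∀ k l, k + l = 2*(x+1)+s →
        pairCoef x s k = if 2 ≤ l then pairCoef x s (l-2) else 0 := by
      intro k l h
      split_ifs with hl
      · exact ih _ _ (by omega)
      · exact pairCoef_zero _ _ _ (by omega)
    rw [pairCoef, pairCoef, ← key k l h, ← key l k (by omega), add_comm]

lemma choose_fst (n k : ℕ) (hk : k ≤ n + 2) :
    (n.choose k : ℝ) * ((n+2)*(n+1)) = ((n+2).choose k) * ((n+2-k)*(n+1-k)) := by
  have h1 := Nat.choose_mul_succ_eq n k
  have h2 := Nat.choose_mul_succ_eq (n+1) k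
  rcases Nat.lt_or_ge (n+1) k with h | h
  · have : k = n + 2 := by omega
    subst this
    rw [Nat.choose_eq_zero_of_lt (by omega : n < n+2)]
    push_cast; ring
  · zify [h, hk] at h1 h2
    have h1' : (n.choose k : ℝ) * (n+1) = ((n+1).choose k) * (n+1-k) := by exact_mod_cast h1
    have h2' : ((n+1).choose k : ℝ) * (n+1+1) = ((n+2).choose k) * (n+1+1-k) := by
      exact_mod_cast h2
    linear_combination (n+2:ℝ) * h1' + (n+1-k:ℝ) * h2'

lemma choose_snd (n k : ℕ) (hk : 2 ≤ k) :
    (n.choose (k-2) : ℝ) * ((n+2)*(n+1)) = ((n+2).choose k) * (k*(k-1)) := by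
  obtain ⟨j, rfl⟩ := Nat.exists_eq_add_of_le' hk
  have h1 := Nat.add_one_mul_choose_eq n j
  have h2 := Nat.add_one_mul_choose_eq (n+1) (j+1)
  have h1' : (n+1:ℝ) * (n.choose j) = ((n+1).choose (j+1)) * (j+1) := by exact_mod_cast h1
  have h2' : (n+1+1:ℝ) * ((n+1).choose (j+1)) = ((n+2).choose (j+2)) * (j+1+1) := by
    exact_mod_cast h2
  have : j + 2 - 2 = j := by omega
  rw [this]; push_cast
  linear_combination (n+2:ℝ) * h1' + (j+1:ℝ) * h2'

/-- Arithmetic core of the inductive step. -/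
lemma step_core (N k x C C1 C2 A1 A2 : ℝ) (hN : 2 ≤ N) (hk0 : 0 ≤ k) (hkN : 2 * k ≤ N)
    (hx : 0 ≤ x) (hxN : 2 * x ≤ N) (hC : 0 ≤ C) (hC1 : 0 ≤ C1) (hC2 : 0 ≤ C2)
    (h1 : C1 * (N * (N-1)) = C * ((N-k)*(N-1-k)))
    (h2 : C2 * (N * (N-1)) = C * (k*(k-1)))
    (hA1 : A1 ≤ C1 * Real.exp (-(1/3*(k-2)*x/N)))
    (hA1' : A1 ≤ C1 * Real.exp (-(1/3*k*x/N)) ∨ N - 1 ≤ 2 * k)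
    (hA2 : A2 ≤ C2 * Real.exp (-(1/3*(k-2)*x/N))) :
    A1 + A2 ≤ C * Real.exp (-(1/3*k*(x+1)/N)) := by
  have hN0 : 0 < N := by linarith
  have hN1 : 0 < N - 1 := by linarith
  have hNN : 0 < N * (N-1) := by positivity
  set q := Real.exp (-(1/3*k*x/N)) with hq
  have hq0 : 0 < q := Real.exp_pos _
  have he2 : Real.exp (-(1/3*(k-2)*x/N)) ≤ q * (7/5) := by
    have e : Real.exp (-(1/3*(k-2)*x/N)) = q * Real.exp (2*x/N/3) := by
      rw [hq, ← Real.exp_add]; congr 1; field_simp; ring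
    rw [e]
    apply mul_le_mul_of_nonneg_left _ hq0.le
    have h3 : 2*x/N ≤ 1 := by rw [div_le_one hN0]; exact hxN
    have h4 : Real.exp (2*x/N/3) ≤ Real.exp (1/3) := Real.exp_le_exp.2 (by linarith)
    refine h4.trans ?_
    have h5 : Real.exp (1/3) ^ 3 = Real.exp 1 := by rw [← Real.exp_nat_mul]; norm_num
    have h6 := Real.exp_one_lt_d9
    by_contra hcon
    push Not at hcon
    have : (7/5:ℝ)^3 < Real.exp (1/3) ^ 3 := by gcongr
    rw [h5] at this
    norm_num at this h6
    linarith
  have hfin : q * (1 - 1/3*(k/N)) ≤ Real.exp (-(1/3*k*(x+1)/N)) := by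
    have e : Real.exp (-(1/3*k*(x+1)/N)) = q * Real.exp (-(1/3*(k/N))) := by
      rw [hq, ← Real.exp_add]; congr 1; field_simp; ring
    rw [e]
    apply mul_le_mul_of_nonneg_left _ hq0.le
    have := Real.add_one_le_exp (-(1/3*(k/N)))
    linarith
  have hA2' : A2 ≤ C2 * (q * (7/5)) := hA2.trans (mul_le_mul_of_nonneg_left he2 hC2)
  have hkN' : k/N ≤ 1/2 := by rw [div_le_iff₀ hN0]; linarith
  have hfin2 := mul_le_mul_of_nonneg_left hfin hC
  refine le_trans ?_ hfin2
  rcases hA1' with h | h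
  · have key : C1 + 7/5*C2 ≤ C * (1 - 1/3*(k/N)) := by
      rw [← mul_le_mul_iff_left₀ hNN]
      have e1 : (C1 + 7/5*C2) * (N*(N-1)) = C * ((N-k)*(N-1-k) + 7/5*(k*(k-1))) := by
        linear_combination h1 + 7/5*h2
      have e2 : C * (1 - 1/3*(k/N)) * (N*(N-1)) = C * ((N - 1/3*k)*(N-1)) := by
        field_simp
      rw [e1, e2]
      apply mul_le_mul_of_nonneg_left _ hC
      nlinarith [mul_nonneg hk0 (sub_nonneg.2 hkN), mul_nonneg hk0 hN1.le]
    have := mul_le_mul_of_nonneg_left key hq0.le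
    nlinarith
  · have hA1'' : A1 ≤ C1 * (q * (7/5)) := hA1.trans (mul_le_mul_of_nonneg_left he2 hC1)
    have key : C1 + C2 ≤ C * (1/2) := by
      rw [← mul_le_mul_iff_left₀ hNN]
      have e1 : (C1 + C2) * (N*(N-1)) = C * ((N-k)*(N-1-k) + (k*(k-1))) := by
        linear_combination h1 + h2
      rw [e1, mul_assoc]
      apply mul_le_mul_of_nonneg_left _ hC
      nlinarith [mul_nonneg (sub_nonneg.2 h) (sub_nonneg.2 hkN)]
    have h7 := mul_le_mul_of_nonneg_left key hq0.le
    have h8 : 0 ≤ C * q := by positivity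
    have h9 : 0 ≤ C * q * (1/2 - k/N) := mul_nonneg h8 (by linarith)
    nlinarith

lemma pairCoef_bound (x s : ℕ) : ∀ k m, m ≤ k → m + k ≤ 2*x+s →
    (pairCoef x s k : ℝ) ≤ ((2*x+s).choose k) * Real.exp (-(1/3*m*x/((2*x+s : ℕ):ℝ))) := by
  induction x with
  | zero => intro k m _ _; simp [pairCoef]
  | succ x ih =>
    have main : ∀ k, 2 * k ≤ 2*(x+1)+s →
        (pairCoef (x+1) s k : ℝ) ≤ ((2*(x+1)+s).choose k) *
          Real.exp (-(1/3*k*((x+1:ℕ):ℝ)/((2*(x+1)+s : ℕ):ℝ))) := by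
      intro k hk
      have e : 2*(x+1)+s = (2*x+s)+2 := by ring
      rw [e] at hk ⊢
      -- the induction hypothesis with the larger denominator
      have ih' : ∀ k (m : ℕ) (r : ℝ), m ≤ k → m + k ≤ 2*x+s → r ≤ m →
          (pairCoef x s k : ℝ) ≤ ((2*x+s).choose k) *
            Real.exp (-(1/3*r*x/((2*x+s : ℕ) + 2:ℝ))) := by
        intro k m r h1 h2 h3
        refine (ih k m h1 h2).trans ?_
        apply mul_le_mul_of_nonneg_left _ (by positivity)
        apply Real.exp_le_exp.2
        apply neg_le_neg
        rcases Nat.eq_zero_or_pos x with rfl | hx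
        · simp
        have hn : (0:ℝ) < ((2*x+s : ℕ):ℝ) := by
          have : 0 < 2*x+s := by omega
          exact_mod_cast this
        calc 1/3*r*x/((2*x+s : ℕ) + 2:ℝ) ≤ 1/3*m*x/((2*x+s : ℕ) + 2:ℝ) := by gcongr
          _ ≤ 1/3*m*x/((2*x+s : ℕ):ℝ) := by gcongr; linarith
      have hle : ∀ k, (pairCoef x s k : ℝ) ≤ ((2*x+s).choose k) := by
        intro k; exact_mod_cast pairCoef_le x s k
      have hxn : 2*x ≤ 2*x+s := by omega
      rw [pairCoef]
      generalize hn : 2*x+s = n at *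
      push_cast
      have hkR : 2*(k:ℝ) ≤ n+2 := by exact_mod_cast hk
      have hxR : 2*(x:ℝ) ≤ n+2 := by
        have : 2*x ≤ n+2 := by omega
        exact_mod_cast this
      have hn0 : (0:ℝ) ≤ n := by positivity
      have hf := choose_fst n k (by omega)
      refine step_core (n+2) k x _ (n.choose k) (if 2 ≤ k then (n.choose (k-2):ℝ) else 0) _ _
        (by linarith) (by positivity) hkR (by positivity) hxR (by positivity) (by positivity)
        (by split_ifs <;> positivity) (by linear_combination hf) ?_ ?_ ?_ ?_
      · split_ifs with h
        · linear_combination choose_snd n k h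
        · have : k = 0 ∨ k = 1 := by omega
          rcases this with rfl | rfl <;> simp
      · rcases Nat.lt_or_ge k 2 with h | h
        · refine (hle k).trans (le_mul_of_one_le_right (by positivity) ?_)
          apply Real.one_le_exp
          have h2 : (k:ℝ) ≤ 2 := by exact_mod_cast h.le
          rw [neg_nonneg]
          apply div_nonpos_of_nonpos_of_nonneg _ (by positivity)
          apply mul_nonpos_of_nonpos_of_nonneg _ (by positivity)
          linarith
        · exact ih' k (k-2) _ (by omega) (by omega) (by push_cast [h]; linarith)
      · rcases Nat.lt_or_ge n (2*k) with h | h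
        · right
          have : (n:ℝ)+1 ≤ 2*k := by exact_mod_cast h
          linarith
        · left
          exact ih' k k _ le_rfl (by omega) le_rfl
      · split_ifs with h
        · exact ih' (k-2) (k-2) _ le_rfl (by omega) (by push_cast [h]; linarith)
        · simp
    have mono : ∀ m k : ℕ, m ≤ k →
        Real.exp (-(1/3*k*((x+1:ℕ):ℝ)/((2*(x+1)+s : ℕ):ℝ))) ≤
        Real.exp (-(1/3*m*((x+1:ℕ):ℝ)/((2*(x+1)+s : ℕ):ℝ))) := by
      intro m k h
      have : (m:ℝ) ≤ k := by exact_mod_cast h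
      apply Real.exp_le_exp.2
      apply neg_le_neg
      gcongr
    intro k m h1 h2
    rcases le_total (2*k) (2*(x+1)+s) with h | h
    · exact (main k h).trans (mul_le_mul_of_nonneg_left (mono m k h1) (by positivity))
    · obtain ⟨l, hl⟩ := Nat.exists_eq_add_of_le (show k ≤ 2*(x+1)+s by omega)
      rw [pairCoef_symm (x+1) s k l hl.symm, Nat.choose_symm_of_eq_add hl]
      exact (main l (by omega)).trans
        (mul_le_mul_of_nonneg_left (mono m l (by omega)) (by positivity))

open Polynomial in
lemma abs_coeff_le (x s : ℕ) : ∀ k,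
    |((1 - X^2 : ℝ[X])^x * (1+X)^s).coeff k| ≤ (pairCoef x s k : ℝ) := by
  induction x with
  | zero => intro k; simp [pairCoef, coeff_one_add_X_pow]
  | succ x ih =>
    intro k
    have e : ((1 - X^2 : ℝ[X])^(x+1) * (1+X)^s) =
      (1 - X^2 : ℝ[X])^x * (1+X)^s - ((1 - X^2 : ℝ[X])^x * (1+X)^s) * X^2 := by ring
    rw [e, coeff_sub, coeff_mul_X_pow', pairCoef]
    push_cast
    refine (abs_sub _ _).trans (add_le_add (ih k) ?_)
    split_ifs
    · exact ih _
    · simp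

open Polynomial in
lemma kraw_sum_eq (n k x : ℕ) (hx : 2 * x ≤ n) :
    ∑ j ∈ Finset.range (k + 1), (-1 : ℝ) ^ j * (x.choose j) * ((n - x).choose (k - j))
      = ((1 - X^2 : ℝ[X])^x * (1+X)^(n-2*x)).coeff k := by
  have e : (1 - X^2 : ℝ[X])^x * (1+X)^(n-2*x) = (1 - X)^x * (1+X)^(n-x) := by
    have h : n - x = x + (n-2*x) := by omega
    rw [h, pow_add, ← mul_assoc, ← mul_pow]
    congr 2; ring
  have hc : ∀ j, ((1 - X : ℝ[X])^x).coeff j = (-1)^j * (x.choose j) := by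
    intro j
    have : (1 - X : ℝ[X])^x = ((1 + X)^x).comp (C (-1) * X) := by
      simp [sub_eq_add_neg]
    rw [this, comp_C_mul_X_coeff, coeff_one_add_X_pow, mul_comm]
  rw [e, coeff_mul, Finset.Nat.sum_antidiagonal_eq_sum_range_succ_mk]
  apply Finset.sum_congr rfl
  intro j _
  rw [hc, coeff_one_add_X_pow]

/-- Exponential bound for Krawtchouk polynomials: `|κ_k^{(n)}(x)| ≤ e^{-c k x / n}`
for `k, x ∈ {0,...,⌊n/2⌋}`. -/
theorem statement10 :
    ∃ c : ℝ, 0 < c ∧ ∀ n k x : ℕ, 1 ≤ n → k ≤ n / 2 → x ≤ n / 2 →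
      |kraw n k x| ≤ Real.exp (-(c * k * x / n)) := by
  refine ⟨1/3, by norm_num, ?_⟩
  intro n k x hn hk hx
  have hC : (0:ℝ) < n.choose k := by exact_mod_cast Nat.choose_pos (by omega)
  rw [kraw, kraw_sum_eq n k x (by omega), abs_mul, abs_of_pos (inv_pos.2 hC),
    inv_mul_le_iff₀ hC]
  have h := pairCoef_bound x (n-2*x) k k le_rfl (by omega)
  have e : 2*x + (n-2*x) = n := by omega
  rw [e] at h
  exact (abs_coeff_le x _ k).trans h
end

section
/- There exists a universal constant C > 0 such that the following holds. Let r ∈ [1, ∞), let 𝔻 := {2^l : l ∈ ℤ}, and for t ∈ (0,∞) let ⌊t⌋_D := max{m ∈ 𝔻 : m ≤ t}. Let Z ⊆ (0, ∞) satisfy ⌊t⌋_D ∈ Z for every t ∈ Z, and let t ↦ a_t be a map from Z into ℂ. Then V_r(a_t : t ∈ Z) ≤ C [ V_r(a_t : t ∈ 𝔻 ∩ Z) + ( Σ_{m ∈ 𝔻} V_r(a_t : t ∈ [m, 2m) ∩ Z)^r )^{1/r} ]. -/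
open scoped ENNReal

/-- The set `𝔻 = {2^l : l ∈ ℤ}` of dyadic numbers. -/
def dyadics : Set ℝ := {x : ℝ | ∃ l : ℤ, x = 2 ^ l}

/-- `⌊t⌋_D`, the largest dyadic number not exceeding `t`. -/
noncomputable def floorD (t : ℝ) : ℝ := 2 ^ Int.log 2 t

namespace S14

/-- increment -/
noncomputable def inc (a : ℝ → ℂ) (x y : ℝ) : ℝ≥0∞ := ENNReal.ofReal ‖a x - a y‖

/-- there is a chain in `Z` ending at `y` with power sum at least `S` -/
def Chain (r : ℝ) (a : ℝ → ℂ) (Z : Set ℝ) (y : ℝ) (S : ℝ≥0∞) : Prop :=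
  ∃ (J : ℕ) (t : Fin (J + 1) → ℝ), StrictMono t ∧ (∀ j, t j ∈ Z) ∧ t (Fin.last J) = y ∧
    S ≤ ∑ j : Fin J, (inc a (t j.castSucc) (t j.succ)) ^ r

lemma inc_self (a : ℝ → ℂ) (x : ℝ) : inc a x x = 0 := by simp [inc]

lemma inc_comm (a : ℝ → ℂ) (x y : ℝ) : inc a x y = inc a y x := by
  simp [inc, norm_sub_rev]

lemma inc_triangle (a : ℝ → ℂ) (x y z : ℝ) : inc a x z ≤ inc a x y + inc a y z := by
  unfold inc
  rw [← ENNReal.ofReal_add (norm_nonneg _) (norm_nonneg _)]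
  exact ENNReal.ofReal_le_ofReal (norm_sub_le_norm_sub_add_norm_sub _ _ _)

lemma chain_nil (r : ℝ) (a : ℝ → ℂ) {Z : Set ℝ} {y : ℝ} (hy : y ∈ Z) : Chain r a Z y 0 :=
  ⟨0, fun _ => y, fun i j h => absurd h (by omega), fun _ => hy, rfl, by simp⟩

lemma Chain.extend {r : ℝ} (hr : 1 ≤ r) {a : ℝ → ℂ} {Z : Set ℝ} {y z : ℝ} {S : ℝ≥0∞}
    (h : Chain r a Z y S) (hyz : y ≤ z) (hz : z ∈ Z) : Chain r a Z z (S + inc a y z ^ r) := by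
  rcases hyz.eq_or_lt with rfl | hlt
  · rw [inc_self, ENNReal.zero_rpow_of_pos (by linarith), add_zero]; exact h
  obtain ⟨J, t, ht, htZ, hl, hS⟩ := h
  refine ⟨J + 1, Fin.snoc (α := fun _ => ℝ) t z, ?_, ?_, ?_, ?_⟩
  · rw [Fin.strictMono_iff_lt_succ]
    intro i
    refine Fin.lastCases ?_ (fun i => ?_) i
    · rw [Fin.succ_last, Fin.snoc_castSucc, Fin.snoc_last, hl]; exact hlt
    · rw [Fin.succ_castSucc, Fin.snoc_castSucc, Fin.snoc_castSucc]
      exact ht Fin.castSucc_lt_succ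
  · intro j
    refine Fin.lastCases ?_ (fun i => ?_) j
    · rwa [Fin.snoc_last]
    · rw [Fin.snoc_castSucc]; exact htZ i
  · rw [Fin.snoc_last]
  · rw [Fin.sum_univ_castSucc]
    simp only [Fin.succ_last, Fin.succ_castSucc, Fin.snoc_castSucc, Fin.snoc_last, hl]
    gcongr

lemma Chain.le {r : ℝ} (hr : 1 ≤ r) {a : ℝ → ℂ} {Z : Set ℝ} {y : ℝ} {S : ℝ≥0∞}
    (h : Chain r a Z y S) : S ≤ eVar r a Z ^ r := by
  obtain ⟨J, t, ht, htZ, -, hS⟩ := h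
  refine hS.trans ?_
  rw [← ENNReal.rpow_inv_le_iff (by linarith)]
  unfold eVar
  exact le_iSup_of_le J (le_iSup_of_le t (le_iSup_of_le ht (le_iSup_of_le htZ le_rfl)))

lemma chain_of_pairs {κ : Type*} [LinearOrder κ] {r : ℝ} (hr : 1 ≤ r) {a : ℝ → ℂ} {Z : Set ℝ}
    (p q : κ → ℝ) (I : Finset κ) :
    (∀ j ∈ I, p j ≤ q j) → (∀ j ∈ I, p j ∈ Z) → (∀ j ∈ I, q j ∈ Z) →
    (∀ j ∈ I, ∀ k ∈ I, j < k → q j ≤ p k) → ∀ x ∈ Z, (∀ j ∈ I, q j ≤ x) →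
    Chain r a Z x (∑ j ∈ I, inc a (p j) (q j) ^ r) := by
  induction I using Finset.induction_on_max with
  | empty => intro _ _ _ _ x hx _; simpa using chain_nil r a hx
  | insert k I hk ih =>
    intro h1 h2 h3 h4 x hx hqx
    have hkI : k ∉ I := fun h => lt_irrefl _ (hk k h)
    have hm : ∀ j ∈ I, j ∈ insert k I := fun j hj => Finset.mem_insert_of_mem hj
    have hkm := Finset.mem_insert_self k I
    have := ih (fun j hj => h1 j (hm j hj)) (fun j hj => h2 j (hm j hj))
      (fun j hj => h3 j (hm j hj)) (fun j hj l hl => h4 j (hm j hj) l (hm l hl)) (p k)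
      (h2 k hkm) (fun j hj => h4 j (hm j hj) k hkm (hk j hj))
    have := (this.extend hr (h1 k hkm) (h3 k hkm)).extend hr (hqx k hkm) hx
    obtain ⟨J, t, a1, a2, a3, a4⟩ := this
    refine ⟨J, t, a1, a2, a3, le_trans ?_ a4⟩
    rw [Finset.sum_insert hkI, add_comm]
    exact le_self_add

lemma pairs_le {κ : Type*} [LinearOrder κ] {r : ℝ} (hr : 1 ≤ r) {a : ℝ → ℂ} {Z : Set ℝ}
    (p q : κ → ℝ) (I : Finset κ)
    (h1 : ∀ j ∈ I, p j ≤ q j) (h2 : ∀ j ∈ I, p j ∈ Z) (h3 : ∀ j ∈ I, q j ∈ Z)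
    (h4 : ∀ j ∈ I, ∀ k ∈ I, j < k → q j ≤ p k) :
    ∑ j ∈ I, inc a (p j) (q j) ^ r ≤ eVar r a Z ^ r := by
  rcases I.eq_empty_or_nonempty with rfl | hne
  · simp
  refine (chain_of_pairs hr p q I h1 h2 h3 h4 (q (I.max' hne)) (h3 _ (I.max'_mem hne)) ?_).le hr
  intro j hj
  rcases (I.le_max' j hj).eq_or_lt with h | h
  · rw [← h]
  · exact (h4 j hj _ (I.max'_mem hne) h).trans (h1 _ (I.max'_mem hne))

lemma blocks_le {κ : Type*} [LinearOrder κ] {r : ℝ} (hr : 1 ≤ r) {a : ℝ → ℂ} (B : ℤ → Set ℝ)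
    (h : κ → ℤ) (p q : κ → ℝ) (I : Finset κ)
    (h1 : ∀ j ∈ I, p j ≤ q j) (h2 : ∀ j ∈ I, p j ∈ B (h j)) (h3 : ∀ j ∈ I, q j ∈ B (h j))
    (h4 : ∀ j ∈ I, ∀ k ∈ I, j < k → h j = h k → q j ≤ p k) :
    ∑ j ∈ I, inc a (p j) (q j) ^ r ≤ ∑' l, eVar r a (B l) ^ r := by
  have e : ∑ j ∈ I, inc a (p j) (q j) ^ r =
      ∑' l : ℤ, ∑ j ∈ I.filter (fun j => h j = l), inc a (p j) (q j) ^ r := by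
    simp_rw [Finset.sum_filter]
    rw [Summable.tsum_finsetSum (fun _ _ => ENNReal.summable)]
    refine Finset.sum_congr rfl fun j _ => ?_
    rw [tsum_eq_single (h j)]
    · simp
    · intro b hb; simp [hb.symm]
  rw [e]
  refine ENNReal.tsum_le_tsum fun l => ?_
  apply pairs_le hr <;> simp only [Finset.mem_filter]
  · rintro j ⟨hj, -⟩; exact h1 j hj
  · rintro j ⟨hj, rfl⟩; exact h2 j hj
  · rintro j ⟨hj, rfl⟩; exact h3 j hj
  · rintro j ⟨hj, hl⟩ k ⟨hk, hl'⟩ hjk; exact h4 j hj k hk hjk (hl.trans hl'.symm)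

lemma floorD_le {t : ℝ} (ht : 0 < t) : floorD t ≤ t := by
  simpa [floorD] using Int.zpow_log_le_self (b := 2) (by norm_num) ht

lemma mem_block {t : ℝ} (ht : 0 < t) :
    t ∈ Set.Ico ((2 : ℝ) ^ Int.log 2 t) ((2 : ℝ) ^ (Int.log 2 t + 1)) :=
  ⟨floorD_le ht, by simpa using Int.lt_zpow_succ_log_self (b := 2) (by norm_num) t⟩

lemma floorD_mem_block (t : ℝ) :
    floorD t ∈ Set.Ico ((2 : ℝ) ^ Int.log 2 t) ((2 : ℝ) ^ (Int.log 2 t + 1)) :=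
  ⟨le_rfl, by unfold floorD; exact zpow_lt_zpow_right₀ (by norm_num) (by omega)⟩

lemma log_mono {s t : ℝ} (hs : 0 < s) (h : s ≤ t) : Int.log 2 s ≤ Int.log 2 t :=
  Int.log_mono_right hs h

lemma floorD_mono {s t : ℝ} (hs : 0 < s) (h : s ≤ t) : floorD s ≤ floorD t :=
  zpow_le_zpow_right₀ (by norm_num) (log_mono hs h)

end S14

/-- Splitting of the `r`-variation into a long (dyadic) part and short parts, for sets
`Z ⊆ (0,∞)` closed under the dyadic floor. -/
theorem statement14 :
    ∃ C : ℝ, 0 < C ∧ ∀ r : ℝ, 1 ≤ r → ∀ Z : Set ℝ, Z ⊆ Set.Ioi 0 →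
      (∀ t ∈ Z, floorD t ∈ Z) → ∀ a : ℝ → ℂ,
      eVar r a Z ≤ ENNReal.ofReal C *
        (eVar r a (dyadics ∩ Z) +
          (∑' l : ℤ, eVar r a (Set.Ico ((2 : ℝ) ^ l) ((2 : ℝ) ^ (l + 1)) ∩ Z) ^ r) ^ r⁻¹) := by
  refine ⟨3, by norm_num, fun r hr Z hZ hfl a => ?_⟩
  set L := eVar r a (dyadics ∩ Z) with hL
  set T := ∑' l : ℤ, eVar r a (Set.Ico ((2 : ℝ) ^ l) ((2 : ℝ) ^ (l + 1)) ∩ Z) ^ r with hT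
  have hr0 : 0 < r := by linarith
  rw [eVar]
  refine iSup_le fun J => iSup_le fun t => iSup_le fun ht => iSup_le fun htZ => ?_
  have hpos : ∀ j, 0 < t j := fun j => hZ (htZ j)
  set n : Fin (J + 1) → ℤ := fun j => Int.log 2 (t j) with hn
  have nmono : Monotone n := fun i j hij => S14.log_mono (hpos i) (ht.monotone hij)
  -- the four pieces
  let f0 : Fin J → ℝ≥0∞ := fun j => S14.inc a (floorD (t j.castSucc)) (floorD (t j.succ))
  let f1 : Fin J → ℝ≥0∞ := fun j =>
    if n j.castSucc = n j.succ then S14.inc a (t j.castSucc) (t j.succ) else 0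
  let f2 : Fin J → ℝ≥0∞ := fun j =>
    if n j.castSucc ≠ n j.succ then S14.inc a (floorD (t j.castSucc)) (t j.castSucc) else 0
  let f3 : Fin J → ℝ≥0∞ := fun j =>
    if n j.castSucc ≠ n j.succ then S14.inc a (floorD (t j.succ)) (t j.succ) else 0
  have hle : ∀ j : Fin J, ENNReal.ofReal ‖a (t j.castSucc) - a (t j.succ)‖ ≤
      f0 j + (f1 j + (f2 j + f3 j)) := by
    intro j
    change S14.inc a (t j.castSucc) (t j.succ) ≤ _
    by_cases h : n j.castSucc = n j.succ
    · simp only [f1, f2, f3, h, if_true, ne_eq, not_true_eq_false, if_false, add_zero]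
      exact le_add_self
    · simp only [f0, f1, f2, f3, h, if_true, ne_eq, not_false_eq_true, if_false, zero_add]
      calc _ ≤ _ := S14.inc_triangle a _ (floorD (t j.castSucc)) _
        _ ≤ S14.inc a (t j.castSucc) (floorD (t j.castSucc)) +
            (S14.inc a (floorD (t j.castSucc)) (floorD (t j.succ)) +
              S14.inc a (floorD (t j.succ)) (t j.succ)) := by
            gcongr; exact S14.inc_triangle a _ _ _
        _ = _ := by rw [S14.inc_comm a (t j.castSucc)]; ring
  have b0 : ∑ j, f0 j ^ r ≤ L ^ r := by
    apply S14.pairs_le hr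
    · intro j _; exact S14.floorD_mono (hpos _) (ht.monotone Fin.castSucc_lt_succ.le)
    · intro j _; exact ⟨⟨_, rfl⟩, hfl _ (htZ _)⟩
    · intro j _; exact ⟨⟨_, rfl⟩, hfl _ (htZ _)⟩
    · intro j _ k _ hjk
      exact S14.floorD_mono (hpos _) (ht.monotone (Fin.succ_le_castSucc_iff.2 hjk))
  have b1 : ∑ j, f1 j ^ r ≤ T := by
    have : ∑ j, f1 j ^ r = ∑ j ∈ Finset.univ.filter (fun j : Fin J => n j.castSucc = n j.succ),
        S14.inc a (t j.castSucc) (t j.succ) ^ r := by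
      rw [Finset.sum_filter]
      refine Finset.sum_congr rfl fun j _ => ?_
      simp only [f1]; split_ifs <;> simp [hr0]
    rw [this]
    apply S14.blocks_le hr (fun l : ℤ => Set.Ico ((2 : ℝ) ^ l) ((2 : ℝ) ^ (l + 1)) ∩ Z)
      (fun j => n j.castSucc) <;> simp only [Finset.mem_filter, Finset.mem_univ, true_and]
    · intro j _; exact ht.monotone Fin.castSucc_lt_succ.le
    · intro j _; exact ⟨S14.mem_block (hpos _), htZ _⟩
    · intro j hj; rw [hj]; exact ⟨S14.mem_block (hpos _), htZ _⟩
    · intro j _ k _ hjk _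
      exact ht.monotone (Fin.succ_le_castSucc_iff.2 hjk)
  have b2 : ∑ j, f2 j ^ r ≤ T := by
    have : ∑ j, f2 j ^ r = ∑ j ∈ Finset.univ.filter (fun j : Fin J => n j.castSucc ≠ n j.succ),
        S14.inc a (floorD (t j.castSucc)) (t j.castSucc) ^ r := by
      rw [Finset.sum_filter]
      refine Finset.sum_congr rfl fun j _ => ?_
      simp only [f2]; split_ifs <;> simp [hr0]
    rw [this]
    apply S14.blocks_le hr (fun l : ℤ => Set.Ico ((2 : ℝ) ^ l) ((2 : ℝ) ^ (l + 1)) ∩ Z)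
      (fun j => n j.castSucc) <;> simp only [Finset.mem_filter, Finset.mem_univ, true_and]
    · intro j _; exact S14.floorD_le (hpos _)
    · intro j _; exact ⟨S14.floorD_mem_block _, hfl _ (htZ _)⟩
    · intro j hj; exact ⟨S14.mem_block (hpos _), htZ _⟩
    · intro j hj k _ hjk he
      have e1 := nmono (Fin.castSucc_lt_succ (i := j)).le
      have e2 := nmono (Fin.succ_le_castSucc_iff.2 hjk)
      omega
  have b3 : ∑ j, f3 j ^ r ≤ T := by
    have : ∑ j, f3 j ^ r = ∑ j ∈ Finset.univ.filter (fun j : Fin J => n j.castSucc ≠ n j.succ),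
        S14.inc a (floorD (t j.succ)) (t j.succ) ^ r := by
      rw [Finset.sum_filter]
      refine Finset.sum_congr rfl fun j _ => ?_
      simp only [f3]; split_ifs <;> simp [hr0]
    rw [this]
    apply S14.blocks_le hr (fun l : ℤ => Set.Ico ((2 : ℝ) ^ l) ((2 : ℝ) ^ (l + 1)) ∩ Z)
      (fun j => n j.succ) <;> simp only [Finset.mem_filter, Finset.mem_univ, true_and]
    · intro j _; exact S14.floorD_le (hpos _)
    · intro j _; exact ⟨S14.floorD_mem_block _, hfl _ (htZ _)⟩
    · intro j hj; exact ⟨S14.mem_block (hpos _), htZ _⟩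
    · intro j _ k hk hjk he
      have e1 := nmono (Fin.castSucc_lt_succ (i := k)).le
      have e2 := nmono (Fin.succ_le_castSucc_iff.2 hjk)
      omega
  have mink : ∀ f g : Fin J → ℝ≥0∞, (∑ j, (f j + g j) ^ r) ^ r⁻¹ ≤
      (∑ j, f j ^ r) ^ r⁻¹ + (∑ j, g j ^ r) ^ r⁻¹ := by
    intro f g
    simpa only [one_div] using ENNReal.Lp_add_le Finset.univ f g hr
  have hri : 0 ≤ r⁻¹ := by positivity
  have c0 : (∑ j, f0 j ^ r) ^ r⁻¹ ≤ L := (ENNReal.rpow_inv_le_iff hr0).2 b0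
  have c1 := ENNReal.rpow_le_rpow b1 hri
  have c2 := ENNReal.rpow_le_rpow b2 hri
  have c3 := ENNReal.rpow_le_rpow b3 hri
  calc _ ≤ (∑ j, (f0 j + (f1 j + (f2 j + f3 j))) ^ r) ^ r⁻¹ := by
        refine ENNReal.rpow_le_rpow (Finset.sum_le_sum fun j _ => ?_) hri
        exact ENNReal.rpow_le_rpow (hle j) hr0.le
    _ ≤ L + (T ^ r⁻¹ + (T ^ r⁻¹ + T ^ r⁻¹)) := by
        refine (mink f0 _).trans (add_le_add c0 ?_)
        refine (mink f1 _).trans (add_le_add c1 ?_)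
        exact (mink f2 _).trans (add_le_add c2 c3)
    _ ≤ (L + L + L) + (T ^ r⁻¹ + (T ^ r⁻¹ + T ^ r⁻¹)) := by
        gcongr; rw [add_assoc]; exact le_self_add
    _ = ENNReal.ofReal 3 * (L + T ^ r⁻¹) := by
        rw [show ENNReal.ofReal 3 = 3 by simp]; ring
end

section
/- For all k, x ∈ {0,...,n}, one has |κ_k^{(n)}(x) − 1| ≤ 2kx/n. -/
lemma vander (x m k : ℕ) :
    ∑ j ∈ Finset.range (k + 1), x.choose j * m.choose (k - j) = (x + m).choose k := by
  rw [Nat.add_choose_eq, Finset.Nat.sum_antidiagonal_eq_sum_range_succ_mk]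

lemma vander_mean (x m k : ℕ) :
    (x + m) * ∑ j ∈ Finset.range (k + 1), j * (x.choose j * m.choose (k - j))
      = k * x * (x + m).choose k := by
  rcases k with _ | k
  · simp
  rcases x with _ | x
  · have h : ∀ j ∈ Finset.range (k + 1 + 1),
        j * ((0 : ℕ).choose j * m.choose (k + 1 - j)) = 0 := by
      intro j _
      rcases j with _ | j <;> simp
    rw [Finset.sum_eq_zero h]
    simp
  · rw [Finset.sum_range_succ']
    have h : ∀ j ∈ Finset.range (k + 1),
        (j + 1) * ((x + 1).choose (j + 1) * m.choose (k + 1 - (j + 1)))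
          = (x + 1) * (x.choose j * m.choose (k - j)) := by
      intro j _
      have := Nat.add_one_mul_choose_eq x j
      rw [Nat.add_sub_add_right, ← mul_assoc, mul_comm (j + 1), ← this, mul_assoc]
    rw [Finset.sum_congr rfl h, ← Finset.mul_sum, vander]
    have := Nat.add_one_mul_choose_eq (x + m) k
    rw [show x + 1 + m = x + m + 1 by ring]
    simp only [zero_mul, add_zero]
    linear_combination (x + 1) * this

/-- `|κ_k^{(n)}(x) - 1| ≤ 2kx/n` for `k, x ∈ {0,...,n}`. -/
theorem statement16 (n k x : ℕ) (hk : k ≤ n) (hx : x ≤ n) :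
    |kraw n k x - 1| ≤ 2 * k * x / n := by
  obtain ⟨m, rfl⟩ := Nat.exists_eq_add_of_le hx
  rcases Nat.eq_zero_or_pos (x + m) with h0 | hn
  · obtain ⟨rfl, rfl⟩ : x = 0 ∧ m = 0 := by omega
    obtain rfl : k = 0 := by omega
    simp [kraw]
  have hC : (0 : ℝ) < ((x + m).choose k : ℝ) := by exact_mod_cast Nat.choose_pos hk
  have hn' : (0 : ℝ) < ((x + m : ℕ) : ℝ) := by exact_mod_cast hn
  have hv : ∑ j ∈ Finset.range (k + 1), (x.choose j : ℝ) * (m.choose (k - j) : ℝ)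
      = ((x + m).choose k : ℝ) := by exact_mod_cast vander x m k
  have hm : ((x + m : ℕ) : ℝ) *
      ∑ j ∈ Finset.range (k + 1), (j : ℝ) * ((x.choose j : ℝ) * (m.choose (k - j) : ℝ))
      = k * x * ((x + m).choose k : ℝ) := by exact_mod_cast vander_mean x m k
  have hb : |∑ j ∈ Finset.range (k + 1), ((-1 : ℝ) ^ j - 1) * ((x.choose j : ℝ) *
      (m.choose (k - j) : ℝ))| ≤
      2 * ∑ j ∈ Finset.range (k + 1), (j : ℝ) * ((x.choose j : ℝ) * (m.choose (k - j) : ℝ)) := by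
    rw [Finset.mul_sum]
    refine (Finset.abs_sum_le_sum_abs _ _).trans (Finset.sum_le_sum fun j _ => ?_)
    have hp : (0 : ℝ) ≤ (x.choose j : ℝ) * (m.choose (k - j) : ℝ) := by positivity
    rw [abs_mul, abs_of_nonneg hp, ← mul_assoc (2 : ℝ)]
    refine mul_le_mul_of_nonneg_right ?_ hp
    rcases Nat.eq_zero_or_pos j with rfl | hj
    · simp
    · have hj' : (1 : ℝ) ≤ j := by exact_mod_cast hj
      rcases neg_one_pow_eq_or ℝ j with h | h <;> rw [h] <;> norm_num <;> linarith
  have he : kraw (x + m) k x - 1 = (((x + m).choose k : ℝ))⁻¹ *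
      ∑ j ∈ Finset.range (k + 1), ((-1 : ℝ) ^ j - 1) * ((x.choose j : ℝ) *
      (m.choose (k - j) : ℝ)) := by
    simp only [sub_mul, one_mul, Finset.sum_sub_distrib]
    rw [hv, mul_sub, inv_mul_cancel₀ hC.ne', kraw, Nat.add_sub_cancel_left]
    simp only [mul_assoc]
  rw [he, abs_mul, abs_of_pos (inv_pos.mpr hC), inv_mul_le_iff₀ hC]
  refine hb.trans (le_of_eq ?_)
  rw [← mul_div_assoc, eq_div_iff hn'.ne']
  linear_combination 2 * hm
end

section
/- There exists a universal constant C > 0 such that for every n and all k, x ∈ {0,...,n} with k ≥ 1, k ≤ n/2, and x ≤ n/2, one has |κ_k^{(n)}(x) − κ_{k−1}^{(n)}(x)| ≤ C/k. -/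
open Polynomial in
/-- generating polynomial -/
noncomputable def genK (x y : ℕ) : ℝ[X] := (1 - X) ^ x * (1 + X) ^ y

open Polynomial in
lemma coeff_one_sub_pow (x j : ℕ) : ((1 - X : ℝ[X]) ^ x).coeff j = (-1) ^ j * (x.choose j : ℝ) := by
  have h : ((1 - X : ℝ[X]) ^ x) = ((1 + X : ℝ[X]) ^ x).comp (C (-1) * X) := by
    simp [sub_eq_add_neg]
  rw [h, comp_C_mul_X_coeff, coeff_one_add_X_pow]
  ring

lemma kraw_eq (n k x : ℕ) : kraw n k x = (genK x (n - x)).coeff k / (n.choose k : ℝ) := by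
  unfold kraw genK
  rw [Polynomial.coeff_mul, Finset.Nat.sum_antidiagonal_eq_sum_range_succ_mk, div_eq_inv_mul]
  congr 1
  apply Finset.sum_congr rfl
  intro j _
  rw [coeff_one_sub_pow, Polynomial.coeff_one_add_X_pow]

open Polynomial in
lemma genK_step (x y k : ℕ) :
    ((k : ℝ) + 1) * (x + y + 3 - k) * (genK (x + 2) (y + 2)).coeff (k + 1) =
      -((x + 2) * (x + 1)) * (genK x (y + 2)).coeff k
        + (y + 2) * (y + 1) * (genK (x + 2) y).coeff k := by
  have h : C ((x : ℝ) + y + 3) * derivative (genK (x + 2) (y + 2))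
      - X * derivative (derivative (genK (x + 2) (y + 2))) =
      C (-(((x : ℝ) + 2) * (x + 1))) * genK x (y + 2) + C (((y : ℝ) + 2) * (y + 1)) * genK (x + 2) y := by
    simp only [genK, derivative_mul, derivative_pow, derivative_add, derivative_sub, derivative_one,
      derivative_X, derivative_natCast, derivative_C, Nat.add_sub_cancel, map_add, map_mul, map_neg,
      map_natCast, map_ofNat, map_one, Nat.cast_add, Nat.cast_ofNat, derivative_ofNat, derivative_zero,
      show x + 2 - 1 = x + 1 by omega, show y + 2 - 1 = y + 1 by omega, Nat.cast_one]
    ring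
  have h2 := congrArg (fun p => coeff p k) h
  simp only [coeff_sub, coeff_add, coeff_C_mul, coeff_derivative] at h2
  rw [← h2]
  cases k with
  | zero => simp
  | succ k =>
    rw [coeff_X_mul, coeff_derivative, coeff_derivative]
    push_cast
    ring

open Polynomial in
lemma genK_diff (x y k : ℕ) :
    ((k : ℝ) + 1) * (genK (x + 1) y).coeff (k + 1) - (x + 1 + y - k) * (genK (x + 1) y).coeff k =
      -2 * (x + 1) * (genK x y).coeff k := by
  have h : (1 + X) * derivative (genK (x + 1) y) - C ((x : ℝ) + 1 + y) * genK (x + 1) y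
      = C (-2 * ((x : ℝ) + 1)) * genK x y := by
    rcases y with _ | y
    · simp [genK, derivative_pow, -map_add, -map_mul]
      simp only [map_add, map_mul, map_neg, map_natCast, map_ofNat, map_one]
      ring
    simp only [genK, derivative_mul, derivative_pow, derivative_add, derivative_sub, derivative_one,
      derivative_X, Nat.add_sub_cancel, map_add, map_mul, map_neg,
      map_natCast, map_ofNat, map_one, Nat.cast_add, Nat.cast_one]
    ring
  have h2 := congrArg (fun p => coeff p k) h
  simp only [coeff_sub, coeff_C_mul, add_mul, one_mul, coeff_add, coeff_derivative] at h2
  rw [← h2]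
  cases k with
  | zero =>
    simp
    ring
  | succ k =>
    rw [coeff_X_mul, coeff_derivative]
    push_cast
    ring

lemma kraw_abs_le_one (n k x : ℕ) (hx : x ≤ n) : |kraw n k x| ≤ 1 := by
  unfold kraw
  rw [abs_mul, abs_inv, Nat.abs_cast]
  have : |∑ j ∈ Finset.range (k + 1), (-1 : ℝ) ^ j * (x.choose j) * ((n - x).choose (k - j))|
      ≤ n.choose k := by
    refine (Finset.abs_sum_le_sum_abs _ _).trans ?_
    have h := Nat.add_choose_eq x (n - x) k
    rw [Nat.add_sub_cancel' hx, Finset.Nat.sum_antidiagonal_eq_sum_range_succ_mk] at h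
    rw [h]
    push_cast
    apply Finset.sum_le_sum
    intro j _
    simp [abs_mul]
  rcases Nat.eq_zero_or_pos (n.choose k) with h0 | h0
  · simp [h0]
  · have : (0 : ℝ) < n.choose k := by exact_mod_cast h0
    rw [inv_mul_le_iff₀ this]
    linarith

lemma kraw_step (x y k : ℕ) (hk : k ≤ x + y + 2) :
    ((x : ℝ) + y + 4) * (x + y + 3) * kraw (x + y + 4) (k + 1) (x + 2) =
      -((x + 2) * (x + 1)) * kraw (x + y + 2) k x + (y + 2) * (y + 1) * kraw (x + y + 2) k (x + 2) := by
  rw [kraw_eq, kraw_eq, kraw_eq]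
  rw [show x + y + 4 - (x + 2) = y + 2 by omega, show x + y + 2 - x = y + 2 by omega,
    show x + y + 2 - (x + 2) = y by omega]
  have hs := genK_step x y k
  have h1 : ((x + y + 4).choose (k + 1) : ℝ) * (k + 1) = (x + y + 4) * (x + y + 3).choose k := by
    have := Nat.add_one_mul_choose_eq (x + y + 3) k
    have h : (((x + y + 3 + 1) * (x + y + 3).choose k : ℕ) : ℝ) = ((x + y + 3 + 1).choose (k + 1) * (k + 1) : ℕ) := by
      rw [this]
    push_cast at h
    linarith
  have h2 : ((x + y + 3).choose k : ℝ) * (x + y + 3 - k) = (x + y + 3) * (x + y + 2).choose k := by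
    have := Nat.choose_mul_succ_eq (x + y + 2) k
    have h : (((x + y + 2).choose k * (x + y + 2 + 1) : ℕ) : ℝ) = ((x + y + 2 + 1).choose k * (x + y + 2 + 1 - k) : ℕ) := by
      rw [this]
    rw [Nat.cast_mul, Nat.cast_mul, Nat.cast_sub (by omega)] at h
    push_cast at h
    linarith
  have p1 : (0 : ℝ) < (x + y + 4).choose (k + 1) := by exact_mod_cast Nat.choose_pos (by omega)
  have p2 : (0 : ℝ) < (x + y + 2).choose k := by exact_mod_cast Nat.choose_pos (by omega)
  have h3 : ((x + y + 4).choose (k + 1) : ℝ) * ((k + 1) * (x + y + 3 - k)) =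
      (x + y + 4) * (x + y + 3) * (x + y + 2).choose k := by
    linear_combination (x + y + 3 - k : ℝ) * h1 + (x + y + 4 : ℝ) * h2
  field_simp
  linear_combination ((x + y + 4).choose (k + 1) : ℝ) * hs - (genK (x + 2) (y + 2)).coeff (k + 1) * h3

lemma kraw_diff (x y k : ℕ) (hk : k ≤ x + y) :
    ((x : ℝ) + y + 1) * (kraw (x + y + 1) (k + 1) (x + 1) - kraw (x + y + 1) k (x + 1)) =
      -2 * (x + 1) * kraw (x + y) k x := by
  rw [kraw_eq, kraw_eq, kraw_eq]
  rw [show x + y + 1 - (x + 1) = y by omega, show x + y - x = y by omega]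
  have hs := genK_diff x y k
  have h1 : ((x + y + 1).choose (k + 1) : ℝ) * (k + 1) = (x + y + 1) * (x + y).choose k := by
    have := Nat.add_one_mul_choose_eq (x + y) k
    have h : (((x + y + 1) * (x + y).choose k : ℕ) : ℝ) = ((x + y + 1).choose (k + 1) * (k + 1) : ℕ) := by
      rw [this]
    push_cast at h
    linarith
  have h2 : ((x + y + 1).choose k : ℝ) * (x + y + 1 - k) = (x + y + 1) * (x + y).choose k := by
    have := Nat.choose_mul_succ_eq (x + y) k
    have h : (((x + y).choose k * (x + y + 1) : ℕ) : ℝ) = ((x + y + 1).choose k * (x + y + 1 - k) : ℕ) := by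
      rw [this]
    rw [Nat.cast_mul, Nat.cast_mul, Nat.cast_sub (by omega)] at h
    push_cast at h
    linarith
  have p1 : (0 : ℝ) < (x + y + 1).choose (k + 1) := by exact_mod_cast Nat.choose_pos (by omega)
  have p3 : (0 : ℝ) < (x + y + 1).choose k := by exact_mod_cast Nat.choose_pos (by omega)
  have p2 : (0 : ℝ) < (x + y).choose k := by exact_mod_cast Nat.choose_pos (by omega)
  have e1 : ((x : ℝ) + y + 1) * ((genK (x + 1) y).coeff (k + 1) / ((x + y + 1).choose (k + 1) : ℝ))
      = (k + 1) * (genK (x + 1) y).coeff (k + 1) / (x + y).choose k := by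
    field_simp
    linear_combination -(genK (x + 1) y).coeff (k + 1) * h1
  have e2 : ((x : ℝ) + y + 1) * ((genK (x + 1) y).coeff k / ((x + y + 1).choose k : ℝ))
      = (x + 1 + y - k) * (genK (x + 1) y).coeff k / (x + y).choose k := by
    field_simp
    linear_combination -(genK (x + 1) y).coeff k * h2
  rw [mul_sub, e1, e2, ← sub_div, hs]
  ring

lemma kraw_decay (N A B j : ℕ) : ∀ n k x : ℕ, x ≤ n → j ≤ k → k + j ≤ n → A + 2 * j ≤ x →
    B + 2 * j ≤ n - x → n ≤ N → |kraw n k x| ≤ (1 - 2 * A * B / (N : ℝ) ^ 2) ^ j := by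
  induction j with
  | zero =>
    intro n k x hx _ _ _ _ _
    simpa using kraw_abs_le_one n k x hx
  | succ j ih =>
    intro n k x hx hjk hkn hA hB hN
    obtain ⟨a, rfl⟩ : ∃ a, x = a + 2 := ⟨x - 2, by omega⟩
    obtain ⟨b, rfl⟩ : ∃ b, n = a + b + 4 := ⟨n - a - 4, by omega⟩
    obtain ⟨k, rfl⟩ : ∃ k', k = k' + 1 := ⟨k - 1, by omega⟩
    have i1 := ih (a + b + 2) k a (by omega) (by omega) (by omega) (by omega) (by omega) (by omega)
    have i2 := ih (a + b + 2) k (a + 2) (by omega) (by omega) (by omega) (by omega) (by omega) (by omega)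
    have hs := kraw_step a b k (by omega)
    set q := (1 - 2 * A * B / (N : ℝ) ^ 2) with hq
    have hqj : 0 ≤ q ^ j := le_trans (abs_nonneg _) i1
    have hA' : (A : ℝ) ≤ a + 2 := by exact_mod_cast (by omega : A ≤ a + 2)
    have hB' : (B : ℝ) ≤ b + 2 := by exact_mod_cast (by omega : B ≤ b + 2)
    have hN' : (a : ℝ) + b + 4 ≤ N := by exact_mod_cast hN
    have ha : (0 : ℝ) ≤ a := Nat.cast_nonneg _
    have hb : (0 : ℝ) ≤ b := Nat.cast_nonneg _
    have hD : (0 : ℝ) < ((a : ℝ) + b + 4) * (a + b + 3) := by positivity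
    have hAB : (A : ℝ) * B ≤ (a + 2) * (b + 2) := by gcongr
    have hDN : ((a : ℝ) + b + 4) * (a + b + 3) ≤ (N : ℝ) ^ 2 := by nlinarith
    have hratio : 2 * A * B / (N : ℝ) ^ 2 * (((a : ℝ) + b + 4) * (a + b + 3)) ≤ 2 * ((a + 2) * (b + 2)) := by
      have hNp : (0 : ℝ) < (N : ℝ) ^ 2 := lt_of_lt_of_le hD hDN
      rw [div_mul_eq_mul_div, div_le_iff₀ hNp]
      have : 2 * ((A : ℝ) * B) * (((a : ℝ) + b + 4) * (a + b + 3)) ≤ 2 * ((a + 2) * (b + 2)) * (N : ℝ) ^ 2 := by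
        gcongr
      linarith
    have hc : ((a : ℝ) + 2) * (a + 1) + (b + 2) * (b + 1) ≤ q * (((a : ℝ) + b + 4) * (a + b + 3)) := by
      rw [hq, sub_mul]; nlinarith
    have key : (((a : ℝ) + b + 4) * (a + b + 3)) * |kraw (a + b + 4) (k + 1) (a + 2)|
        ≤ (((a : ℝ) + b + 4) * (a + b + 3)) * q ^ (j + 1) := by
      rw [← abs_of_pos hD, ← abs_mul, abs_of_pos hD, hs]
      calc _ ≤ ((a : ℝ) + 2) * (a + 1) * |kraw (a + b + 2) k a| + (b + 2) * (b + 1) * |kraw (a + b + 2) k (a + 2)| := by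
            refine (abs_add_le _ _).trans (le_of_eq ?_)
            rw [abs_mul, abs_mul, abs_neg, abs_of_nonneg (by positivity : (0 : ℝ) ≤ ((a : ℝ) + 2) * (a + 1)),
              abs_of_nonneg (by positivity : (0 : ℝ) ≤ ((b : ℝ) + 2) * (b + 1))]
        _ ≤ ((a : ℝ) + 2) * (a + 1) * q ^ j + (b + 2) * (b + 1) * q ^ j := by gcongr
        _ = (((a : ℝ) + 2) * (a + 1) + (b + 2) * (b + 1)) * q ^ j := by ring
        _ ≤ q * (((a : ℝ) + b + 4) * (a + b + 3)) * q ^ j := by gcongr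
        _ = _ := by ring
    exact le_of_mul_le_mul_left key hD

lemma choose_symm_aux (n k x j : ℕ) (hk : k ≤ n) (hx : x ≤ n) (hjk : j ≤ k) (hjx : j ≤ x) :
    n.choose x * x.choose j * (n - x).choose (k - j) =
      n.choose k * k.choose j * (n - k).choose (x - j) := by
  rw [Nat.choose_mul hjx, Nat.choose_mul hjk, mul_assoc, mul_assoc]
  congr 1
  obtain ⟨a, rfl⟩ : ∃ a, x = j + a := ⟨x - j, by omega⟩
  obtain ⟨b, rfl⟩ : ∃ b, k = j + b := ⟨k - j, by omega⟩
  obtain ⟨N, rfl⟩ : ∃ N, n = j + N := ⟨n - j, by omega⟩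
  simp only [Nat.add_sub_cancel_left, Nat.add_sub_add_left]
  have h1 := Nat.choose_mul (n := N) (k := a + b) (s := a) (by omega)
  have h2 := Nat.choose_mul (n := N) (k := a + b) (s := b) (by omega)
  rw [Nat.add_sub_cancel_left] at h1
  rw [Nat.add_sub_cancel] at h2
  rw [← h1, ← h2, Nat.choose_symm_add]

lemma kraw_symm_le (n k x : ℕ) (hx : x ≤ n) (h : k ≤ x) : kraw n k x = kraw n x k := by
  unfold kraw
  have p1 : (n.choose k : ℝ) ≠ 0 := by exact_mod_cast (Nat.choose_pos (h.trans hx)).ne'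
  have p2 : (n.choose x : ℝ) ≠ 0 := by exact_mod_cast (Nat.choose_pos hx).ne'
  have hsub : ∑ j ∈ Finset.range (k + 1), (-1 : ℝ) ^ j * (k.choose j) * ((n - k).choose (x - j))
      = ∑ j ∈ Finset.range (x + 1), (-1 : ℝ) ^ j * (k.choose j) * ((n - k).choose (x - j)) := by
    apply Finset.sum_subset
    · intro j; simp; omega
    · intro j _ hj
      rw [Nat.choose_eq_zero_of_lt (by simpa using hj)]
      simp
  rw [← hsub, inv_mul_eq_div, inv_mul_eq_div, div_eq_div_iff p1 p2, Finset.sum_mul, Finset.sum_mul]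
  apply Finset.sum_congr rfl
  intro j hj
  have hj' : j ≤ k := by simpa [Nat.lt_succ_iff] using hj
  have e : ((n.choose x * x.choose j * (n - x).choose (k - j) : ℕ) : ℝ) =
      (n.choose k * k.choose j * (n - k).choose (x - j) : ℕ) := by
    rw [choose_symm_aux n k x j (h.trans hx) hx hj' (hj'.trans h)]
  push_cast at e
  linear_combination (-1 : ℝ) ^ j * e

lemma kraw_bound_le (m c d : ℕ) (hcd : c ≤ d) (hd : 2 * d + 1 ≤ m) :
    ((c : ℝ) + 1) * (d + 1) * |kraw m c d| ≤ 40 * (m + 1) := by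
  have h1 := kraw_abs_le_one m c d (by omega)
  have hdm : 2 * (d : ℝ) + 1 ≤ m := by exact_mod_cast hd
  have hd0 : (0 : ℝ) ≤ d := Nat.cast_nonneg _
  have hc0 : (0 : ℝ) ≤ c := Nat.cast_nonneg _
  rcases Nat.lt_or_ge c 4 with h4 | h4
  · have hc : (c : ℝ) + 1 ≤ 4 := by exact_mod_cast h4
    calc ((c : ℝ) + 1) * (d + 1) * |kraw m c d| ≤ 4 * (d + 1) * 1 := by gcongr
      _ ≤ _ := by linarith
  obtain ⟨j, hj1, hj2, hj3⟩ : ∃ j, 1 ≤ j ∧ 4 * j ≤ c ∧ c + 1 ≤ 4 * j + 4 := ⟨c / 4, by omega, by omega, by omega⟩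
  have hdec := kraw_decay m (d - 2 * j) (m - d - 2 * j) j m c d (by omega) (by omega) (by omega)
    (by omega) (by omega) le_rfl
  have hA : (d : ℝ) / 2 ≤ ((d - 2 * j : ℕ) : ℝ) := by
    rw [div_le_iff₀ (by norm_num)]
    exact_mod_cast (by omega : d ≤ (d - 2 * j) * 2)
  have hB : (m : ℝ) / 4 ≤ ((m - d - 2 * j : ℕ) : ℝ) := by
    rw [div_le_iff₀ (by norm_num)]
    exact_mod_cast (by omega : m ≤ (m - d - 2 * j) * 4)
  have hm : (0 : ℝ) < m := by linarith
  have hdp : (4 : ℝ) ≤ d := by exact_mod_cast (by omega : 4 ≤ d)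
  have hjp : (1 : ℝ) ≤ j := by exact_mod_cast hj1
  have hcj : (c : ℝ) + 1 ≤ 4 * j + 4 := by exact_mod_cast hj3
  set t := 2 * ((d - 2 * j : ℕ) : ℝ) * ((m - d - 2 * j : ℕ) : ℝ) / (m : ℝ) ^ 2 with ht
  have htd : (d : ℝ) / (4 * m) ≤ t := by
    rw [ht, div_le_div_iff₀ (by positivity) (by positivity)]
    have : (d : ℝ) / 2 * (m / 4) ≤ ((d - 2 * j : ℕ) : ℝ) * ((m - d - 2 * j : ℕ) : ℝ) := by gcongr
    nlinarith
  have ht1 : t ≤ 1 := by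
    rw [ht, div_le_one (by positivity)]
    have e : (((d - 2 * j : ℕ) : ℝ)) + ((m - d - 2 * j : ℕ) : ℝ) ≤ m := by
      exact_mod_cast (by omega : (d - 2 * j) + (m - d - 2 * j) ≤ m)
    nlinarith [sq_nonneg (((d - 2 * j : ℕ) : ℝ)), sq_nonneg (((m - d - 2 * j : ℕ) : ℝ)),
      Nat.cast_nonneg (α := ℝ) (d - 2 * j), Nat.cast_nonneg (α := ℝ) (m - d - 2 * j)]
  have ht0 : 0 ≤ t := le_trans (by positivity) htd
  have hpow : (1 - t) ^ j * (1 + j * t) ≤ 1 := by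
    have hb := one_add_mul_le_pow (a := t) (by linarith) j
    calc (1 - t) ^ j * (1 + j * t) ≤ (1 - t) ^ j * (1 + t) ^ j := by
          have : 0 ≤ (1 - t) ^ j := pow_nonneg (by linarith) _
          gcongr
      _ = (1 - t ^ 2) ^ j := by rw [← mul_pow]; ring
      _ ≤ 1 := pow_le_one₀ (by nlinarith) (by nlinarith)
  have hK : |kraw m c d| * (j * (d / (4 * m))) ≤ 1 := by
    calc |kraw m c d| * (j * (d / (4 * m))) ≤ (1 - t) ^ j * (1 + j * t) := by
          have : (j : ℝ) * (d / (4 * m)) ≤ j * t := by gcongr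
          have h0 : (0 : ℝ) ≤ j * (d / (4 * m)) := by positivity
          exact mul_le_mul hdec (by linarith) h0 ((abs_nonneg _).trans hdec)
      _ ≤ 1 := hpow
  have hK2 : |kraw m c d| * (j * d) ≤ 4 * m := by
    have : |kraw m c d| * (j * (d / (4 * m))) = |kraw m c d| * (j * d) / (4 * m) := by ring
    rw [this, div_le_one (by positivity)] at hK
    exact hK
  have hprod : ((c : ℝ) + 1) * (d + 1) ≤ 10 * (j * d) := by
    calc ((c : ℝ) + 1) * (d + 1) ≤ (8 * j) * (5 / 4 * d) := by
          apply mul_le_mul <;> linarith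
      _ = _ := by ring
  calc ((c : ℝ) + 1) * (d + 1) * |kraw m c d| ≤ 10 * (j * d) * |kraw m c d| := by gcongr
    _ = 10 * (|kraw m c d| * (j * d)) := by ring
    _ ≤ 40 * (m + 1) := by linarith

lemma kraw_bound (m c d : ℕ) (hc : 2 * c + 1 ≤ m) (hd : 2 * d + 1 ≤ m) :
    ((c : ℝ) + 1) * (d + 1) * |kraw m c d| ≤ 40 * (m + 1) := by
  rcases le_total c d with h | h
  · exact kraw_bound_le m c d h hd
  · rw [← kraw_symm_le m d c (by omega) h]
    have := kraw_bound_le m d c h hc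
    linarith

/-- `|κ_k^{(n)}(x) - κ_{k-1}^{(n)}(x)| ≲ 1/k` for `1 ≤ k ≤ n/2` and `x ≤ n/2`. -/
theorem statement18 :
    ∃ C : ℝ, 0 < C ∧ ∀ n k x : ℕ, 1 ≤ k →
      (k : ℝ) ≤ (n : ℝ) / 2 → (x : ℝ) ≤ (n : ℝ) / 2 →
      |kraw n k x - kraw n (k - 1) x| ≤ C / k := by
  refine ⟨80, by norm_num, ?_⟩
  intro n k x hk hkn hxn
  have hkn' : 2 * k ≤ n := by
    have : 2 * (k : ℝ) ≤ n := by linarith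
    exact_mod_cast this
  have hxn' : 2 * x ≤ n := by
    have : 2 * (x : ℝ) ≤ n := by linarith
    exact_mod_cast this
  obtain ⟨k, rfl⟩ : ∃ k', k = k' + 1 := ⟨k - 1, by omega⟩
  rw [Nat.add_sub_cancel]
  rcases x with _ | x
  · have h0 : ∀ l, l ≤ n → kraw n l 0 = 1 := by
      intro l hl
      rw [kraw_eq n l 0]
      have : (n.choose l : ℝ) ≠ 0 := by exact_mod_cast (Nat.choose_pos hl).ne'
      simp [genK, Polynomial.coeff_one_add_X_pow, this]
    rw [h0 _ (by omega), h0 _ (by omega)]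
    simp
    positivity
  obtain ⟨y, rfl⟩ : ∃ y, n = x + y + 1 := ⟨n - x - 1, by omega⟩
  have hd := kraw_diff x y k (by omega)
  have hb := kraw_bound (x + y) k x (by omega) (by omega)
  have hn : (0 : ℝ) < (x : ℝ) + y + 1 := by positivity
  rw [le_div_iff₀ (by positivity)]
  have habs : ((x : ℝ) + y + 1) * |kraw (x + y + 1) (k + 1) (x + 1) - kraw (x + y + 1) k (x + 1)|
      = 2 * (x + 1) * |kraw (x + y) k x| := by
    rw [← abs_of_pos hn, ← abs_mul, hd, abs_mul, abs_mul, abs_neg, abs_of_pos (by norm_num : (0 : ℝ) < 2),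
      abs_of_pos (by positivity : (0 : ℝ) < (x : ℝ) + 1)]
  push_cast at hb ⊢
  refine le_of_mul_le_mul_left ?_ hn
  calc _ = (((x : ℝ) + y + 1) * |kraw (x + y + 1) (k + 1) (x + 1) - kraw (x + y + 1) k (x + 1)|) * (k + 1) := by ring
    _ = 2 * ((k + 1) * (x + 1) * |kraw (x + y) k x|) := by rw [habs]; ring
    _ ≤ _ := by linarith
end
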